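/- arXiv:1011.5652 — 12 statements merged into one kernel-verified Lean document; each statement's English description precedes it below -/
import Mathlib

section
/- Let m and n be distinct positive integers such that their ratio is not a nonzero integer power of a prime, i.e., there is no prime p and no integer e ≥ 1 with m = n·p^e or n = m·p^e. Then the cyclotomic polynomials Φ_n(q) and Φ_m(q) generate the unit ideal of ℤ[q]; equivalently, Φ_n(q) and Φ_m(q) are coprime elements of the polynomial ring ℤ[q]. -/
open Polynomial

theorem IsPrimitiveRoot.of_isRoot_cyclotomic_prime_pow_mul {K : Type*} [Field K] (p : ℕ)
    [Fact p.Prime] [CharP K p] {k n : ℕ} (hn : ¬ p ∣ n) {x : K}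
    (hx : (cyclotomic (p ^ k * n) K).IsRoot x) : IsPrimitiveRoot x n := by
  have : NeZero (n : K) := ⟨by rwa [Ne, CharP.cast_eq_zero_iff K p]⟩
  exact isRoot_cyclotomic_prime_pow_mul_iff_of_charP.1 hx

/-- If two cyclotomic polynomials have a common root in a field, then their indices are equal or
differ by a prime power factor. -/
theorem Polynomial.eq_or_eq_mul_prime_pow_of_isRoot_cyclotomic {K : Type*} [Field K] {m n : ℕ}
    (hm : 0 < m) (hn : 0 < n) {x : K} (hxm : (cyclotomic m K).IsRoot x)
    (hxn : (cyclotomic n K).IsRoot x) :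
    m = n ∨ ∃ p e : ℕ, p.Prime ∧ 1 ≤ e ∧ (m = n * p ^ e ∨ n = m * p ^ e) := by
  obtain hK | ⟨p, hp, hK⟩ := CharP.exists' K
  · exact .inl (((isRoot_cyclotomic_iff_charZero hm).1 hxm).unique
      ((isRoot_cyclotomic_iff_charZero hn).1 hxn))
  · obtain ⟨a, m, hm', rfl⟩ := Nat.exists_eq_pow_mul_and_not_dvd hm.ne' p hp.out.ne_one
    obtain ⟨b, n, hn', rfl⟩ := Nat.exists_eq_pow_mul_and_not_dvd hn.ne' p hp.out.ne_one
    obtain rfl : m = n :=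
      (IsPrimitiveRoot.of_isRoot_cyclotomic_prime_pow_mul p hm' hxm).unique
        (IsPrimitiveRoot.of_isRoot_cyclotomic_prime_pow_mul p hn' hxn)
    rcases lt_trichotomy a b with hab | rfl | hab
    · obtain ⟨e, rfl⟩ := Nat.exists_eq_add_of_lt hab
      exact .inr ⟨p, e + 1, hp.out, by lia, .inr (by ring)⟩
    · exact .inl rfl
    · obtain ⟨e, rfl⟩ := Nat.exists_eq_add_of_lt hab
      exact .inr ⟨p, e + 1, hp.out, by lia, .inl (by ring)⟩

theorem stmt_0 (m n : ℕ) (hm : 0 < m) (hn : 0 < n) (hmn : m ≠ n)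
    (h : ∀ (p e : ℕ), p.Prime → 1 ≤ e → m ≠ n * p ^ e ∧ n ≠ m * p ^ e) :
    IsCoprime (cyclotomic n ℤ) (cyclotomic m ℤ) := by
  by_contra hco
  obtain ⟨M, hM, hle⟩ := Ideal.exists_le_maximal (Ideal.span {cyclotomic n ℤ, cyclotomic m ℤ})
    fun htop ↦ hco <| Ideal.mem_span_pair.1 ((Ideal.eq_top_iff_one _).1 htop)
  let _ : Field (ℤ[X] ⧸ M) := Ideal.Quotient.field M
  have isRoot {k : ℕ} (hk : cyclotomic k ℤ ∈ M) :
      (cyclotomic k (ℤ[X] ⧸ M)).IsRoot (Ideal.Quotient.mk M X) := by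
    rw [IsRoot, ← map_cyclotomic_int, eval_map, ← coe_eval₂RingHom,
      RingHom.ext_iff.1 (Polynomial.ringHom_ext (by simp) (by simp) :
        eval₂RingHom (Int.castRingHom (ℤ[X] ⧸ M)) (Ideal.Quotient.mk M X) = Ideal.Quotient.mk M)]
    exact Ideal.Quotient.eq_zero_iff_mem.2 hk
  obtain heq | ⟨p, e, hp, he, hpe⟩ := eq_or_eq_mul_prime_pow_of_isRoot_cyclotomic hm hn
    (isRoot (hle (Ideal.subset_span (by simp)))) (isRoot (hle (Ideal.subset_span (by simp))))
  · exact hmn heq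
  · exact hpe.elim (h p e hp he).1 (h p e hp he).2
end

section
/- Let p be a prime, let n be a positive integer and let e be an integer with e ≥ 1, and set m = n·p^e. Then the images of the cyclotomic polynomials Φ_n(q) and Φ_m(q) generate the unit ideal of the polynomial ring ℤ[1/p][q] over the localization of ℤ away from p; equivalently, Φ_n(q) and Φ_m(q) are coprime in ℤ[1/p][q]. -/
open Polynomial

/-- If `d` properly divides `d * k`, then `Φ_{dk}` divides `∑_{i < k} X ^ (d i)`. -/
theorem cyclotomic_mul_dvd_geom_sum {d k : ℕ} (hd : 0 < d) (hk : 1 < k) :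
    cyclotomic (d * k) ℤ ∣ ∑ i ∈ Finset.range k, ((X : ℤ[X]) ^ d) ^ i := by
  have hmem : d ∈ (d * k).properDivisors :=
    Nat.mem_properDivisors.2 ⟨dvd_mul_right d k, lt_mul_of_one_lt_right hd hk⟩
  have h := X_pow_sub_one_mul_cyclotomic_dvd_X_pow_sub_one_of_dvd ℤ hmem
  rw [pow_mul, ← mul_geom_sum (X ^ d)] at h
  exact (mul_dvd_mul_iff_left (X_pow_sub_C_ne_zero hd (1 : ℤ))).1 (by rwa [C_1])

/-- A geometric sum of length `k` is coprime to `y - 1` as soon as `k` is invertible. -/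
theorem isCoprime_sub_one_geom_sum {R : Type*} [CommRing R] (y : R) {k : ℕ}
    (hk : IsUnit (k : R)) : IsCoprime (y - 1) (∑ i ∈ Finset.range k, y ^ i) := by
  obtain ⟨c, hc⟩ : y - 1 ∣ (∑ i ∈ Finset.range k, y ^ i) - k := by
    have h : (∑ i ∈ Finset.range k, y ^ i) - k = ∑ i ∈ Finset.range k, (y ^ i - 1) := by
      simp
    rw [h]
    exact Finset.dvd_sum fun i _ => sub_one_dvd_pow_sub_one y i
  rw [sub_eq_iff_eq_add.1 hc, add_comm, IsCoprime.add_mul_left_right_iff]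
  exact isCoprime_one_right.mono dvd_rfl hk.dvd

theorem stmt_1 (p : ℕ) (hp : p.Prime) (n e : ℕ) (hn : 0 < n) (he : 1 ≤ e) :
    IsCoprime
      ((cyclotomic n ℤ).map (algebraMap ℤ (Localization.Away (p : ℤ))))
      ((cyclotomic (n * p ^ e) ℤ).map (algebraMap ℤ (Localization.Away (p : ℤ)))) := by
  obtain ⟨f, rfl⟩ : ∃ f, e = f + 1 := ⟨e - 1, by omega⟩
  set R := Localization.Away (p : ℤ)
  have hunit : IsUnit ((p : ℕ) : R[X]) := by
    have h : IsUnit (algebraMap ℤ R (p : ℤ)) := IsLocalization.Away.algebraMap_isUnit _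
    simpa using h.map (C : R →+* R[X])
  have hcop := isCoprime_sub_one_geom_sum ((X : R[X]) ^ (n * p ^ f)) hunit
  have hleft : cyclotomic n ℤ ∣ X ^ (n * p ^ f) - 1 :=
    (cyclotomic.dvd_X_pow_sub_one n ℤ).trans
      (pow_one_sub_dvd_pow_mul_sub_one X n (p ^ f))
  have hright := cyclotomic_mul_dvd_geom_sum (Nat.mul_pos hn (pow_pos hp.pos f)) hp.one_lt
  rw [mul_assoc, ← pow_succ] at hright
  have hleft' := Polynomial.map_dvd (algebraMap ℤ R) hleft
  have hright' := Polynomial.map_dvd (algebraMap ℤ R) hright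
  simp only [Polynomial.map_sub, Polynomial.map_pow, map_X, Polynomial.map_one,
    Polynomial.map_sum] at hleft' hright'
  exact (hcop.of_isCoprime_of_dvd_left hleft').of_isCoprime_of_dvd_right hright'
end

section
/- Let n ≥ 1 and k ≥ 1 be integers and let ζ ∈ ℂ be a primitive n-th root of unity. For every polynomial f ∈ ℤ[X], the power Φ_n(X)^k divides f in ℤ[X] if and only if (X − ζ)^k divides f in ℂ[X]. Equivalently, the ℤ-algebra homomorphism from ℤ[q]/(Φ_n(q)^k) to ℤ[ζ][x]/(x^k) determined by q ↦ ζ + x is well defined and injective. -/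
open Polynomial

/-- If `ζ` is a complex primitive `n`-th root of unity and `(X - ζ) ^ k` divides an integer
polynomial over `ℂ`, then `Φ_n ^ k` divides it over `ℤ`. -/
theorem cyclotomic_pow_dvd_of_X_sub_C_pow_dvd_map {n : ℕ} (hn : 0 < n) {ζ : ℂ}
    (hζ : IsPrimitiveRoot ζ n) (k : ℕ) {f : ℤ[X]}
    (h : (X - C ζ) ^ k ∣ f.map (Int.castRingHom ℂ)) :
    cyclotomic n ℤ ^ k ∣ f := by
  induction k generalizing f with
  | zero => simp
  | succ k ih =>
    have hroot : aeval ζ f = 0 := by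
      have hdvd : X - C ζ ∣ f.map (Int.castRingHom ℂ) :=
        (dvd_pow_self _ k.succ_ne_zero).trans h
      simpa [dvd_iff_isRoot, IsRoot.def, eval_map, aeval_def] using hdvd
    obtain ⟨g, rfl⟩ : cyclotomic n ℤ ∣ f := by
      rw [cyclotomic_eq_minpoly hζ hn]
      exact minpoly.isIntegrallyClosed_dvd (hζ.isIntegral hn) hroot
    obtain ⟨q, hq⟩ : X - C ζ ∣ cyclotomic n ℂ :=
      dvd_iff_isRoot.mpr (hζ.isRoot_cyclotomic hn)
    have : NeZero (n : ℂ) := ⟨Nat.cast_ne_zero.mpr hn.ne'⟩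
    have hsep : ((X - C ζ) * q).Separable := hq ▸ separable_cyclotomic n ℂ
    rw [Polynomial.map_mul, map_cyclotomic, hq, mul_assoc, pow_succ'] at h
    rw [pow_succ']
    exact mul_dvd_mul_left _ (ih (hsep.isCoprime.pow_left.dvd_of_dvd_mul_left
      ((mul_dvd_mul_iff_left (X_sub_C_ne_zero ζ)).mp h)))

theorem stmt_2 (n k : ℕ) (hn : 1 ≤ n) (hk : 1 ≤ k) (ζ : ℂ)
    (hζ : IsPrimitiveRoot ζ n) (f : Polynomial ℤ) :
    (cyclotomic n ℤ) ^ k ∣ f ↔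
      (X - C ζ) ^ k ∣ f.map (Int.castRingHom ℂ) := by
  refine ⟨fun h ↦ ?_, cyclotomic_pow_dvd_of_X_sub_C_pow_dvd_map hn hζ k⟩
  have hmap : cyclotomic n ℂ ^ k ∣ f.map (Int.castRingHom ℂ) := by
    simpa using Polynomial.map_dvd (Int.castRingHom ℂ) h
  exact (pow_dvd_pow_of_dvd (dvd_iff_isRoot.mpr (hζ.isRoot_cyclotomic hn)) k).trans hmap
end

section
/- Let n, k, b be positive integers with b coprime to n, and let E = ℤ[q]/(Φ_n(q)^k), which is a free ℤ-module of rank k·φ(n). The ring endomorphism F_b of E induced by q ↦ q^b has image a free ℤ-submodule of E of full rank k·φ(n), and the index of F_b(E) in E (i.e., the cardinality of the quotient abelian group E/F_b(E)) equals b^{k(k−1)φ(n)/2}. -/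
open Polynomial

/-- The determinant of an endomorphism of a short exact sequence is multiplicative. -/
theorem LinearMap.det_eq_mul_of_exact {R M' M M'' : Type*} [CommRing R]
    [AddCommGroup M'] [AddCommGroup M] [AddCommGroup M''] [Module R M'] [Module R M]
    [Module R M''] [Module.Free R M'] [Module.Finite R M'] [Module.Finite R M]
    [Module.Free R M''] {i : M' →ₗ[R] M} {p : M →ₗ[R] M''} (hi : Function.Injective i)
    (hp : Function.Surjective p) (hip : Function.Exact i p)
    {f' : M' →ₗ[R] M'} {f : M →ₗ[R] M} {f'' : M'' →ₗ[R] M''}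
    (h₁ : f ∘ₗ i = i ∘ₗ f') (h₂ : p ∘ₗ f = f'' ∘ₗ p) :
    f.det = f'.det * f''.det := by
  let e' : M' ≃ₗ[R] i.range := LinearEquiv.ofInjective i hi
  let e'' : (M ⧸ i.range) ≃ₗ[R] M'' := hip.linearEquivOfSurjective hp
  have : Module.Free R i.range := .of_equiv e'
  have : Module.Finite R i.range := .equiv e'
  have : Module.Free R (M ⧸ i.range) := .of_equiv e''.symm
  have hW : i.range ≤ i.range.comap f := by
    rintro _ ⟨x, rfl⟩
    exact ⟨f' x, (LinearMap.congr_fun h₁ x).symm⟩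
  rw [f.det_eq_det_mul_det i.range hW, ← LinearMap.det_conj f' e',
    ← LinearMap.det_conj (Submodule.mapQ _ _ f hW) e'']
  congr 2
  · ext x
    obtain ⟨x, rfl⟩ := e'.surjective x
    simpa [e'] using LinearMap.congr_fun h₁ x
  · ext y
    obtain ⟨x, rfl⟩ := hp y
    have hx : e''.symm (p x) = Submodule.Quotient.mk x := by
      rw [LinearEquiv.symm_apply_eq]
      rfl
    simp only [LinearMap.comp_apply, LinearEquiv.coe_coe, hx, Submodule.mapQ_apply]
    exact LinearMap.congr_fun h₂ x

/-- An injective endomorphism of a finite free abelian group has image of index `|det|`. -/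
theorem LinearMap.index_range_eq_natAbs_det {M : Type*} [AddCommGroup M] [Module.Free ℤ M]
    [Module.Finite ℤ M] (f : M →ₗ[ℤ] M) (hf : Function.Injective f) :
    f.range.toAddSubgroup.index = f.det.natAbs :=
  (Submodule.natAbs_det_equiv f.range (LinearEquiv.ofInjective f hf)).symm

/-- Multiplication by `g` as a map `ℤ[X] ⧸ (f) → ℤ[X] ⧸ (g * f)`. -/
noncomputable def Polynomial.quotientMulLeft (g f : ℤ[X]) :
    (ℤ[X] ⧸ Ideal.span {f}) →ₗ[ℤ] (ℤ[X] ⧸ Ideal.span {g * f}) :=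
  (Submodule.mapQ (Ideal.span {f}) (Ideal.span {g * f}) (LinearMap.mulLeft ℤ[X] g) (by
    rw [Ideal.span, Submodule.span_le, Set.singleton_subset_iff]
    exact Ideal.mem_span_singleton_self _)).toAddMonoidHom.toIntLinearMap

/-- The reduction map `ℤ[X] ⧸ (g * f) → ℤ[X] ⧸ (g)`. -/
noncomputable def Polynomial.quotientFactorLeft (g f : ℤ[X]) :
    (ℤ[X] ⧸ Ideal.span {g * f}) →ₗ[ℤ] (ℤ[X] ⧸ Ideal.span {g}) :=
  (Ideal.Quotient.factor (Ideal.span_singleton_le_span_singleton.2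
    (dvd_mul_right g f))).toAddMonoidHom.toIntLinearMap

namespace Polynomial

theorem quotientMulLeft_mk (g f a : ℤ[X]) :
    quotientMulLeft g f (Ideal.Quotient.mk _ a) = Ideal.Quotient.mk _ (g * a) := rfl

theorem quotientFactorLeft_mk (g f a : ℤ[X]) :
    quotientFactorLeft g f (Ideal.Quotient.mk _ a) = Ideal.Quotient.mk _ a := rfl

theorem quotientMulLeft_injective {g : ℤ[X]} (hg : g ≠ 0) (f : ℤ[X]) :
    Function.Injective (quotientMulLeft g f) := by
  rw [injective_iff_map_eq_zero]
  intro x hx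
  obtain ⟨a, rfl⟩ := Ideal.Quotient.mk_surjective x
  rw [quotientMulLeft_mk, Ideal.Quotient.eq_zero_iff_dvd] at hx
  exact (Ideal.Quotient.eq_zero_iff_dvd _ _).2 ((mul_dvd_mul_iff_left hg).1 hx)

theorem quotientFactorLeft_surjective (g f : ℤ[X]) :
    Function.Surjective (quotientFactorLeft g f) := fun y ↦ by
  obtain ⟨a, rfl⟩ := Ideal.Quotient.mk_surjective y
  exact ⟨Ideal.Quotient.mk _ a, rfl⟩

theorem exact_quotientMulLeft_quotientFactorLeft (g f : ℤ[X]) :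
    Function.Exact (quotientMulLeft g f) (quotientFactorLeft g f) := by
  intro y
  obtain ⟨a, rfl⟩ := Ideal.Quotient.mk_surjective y
  rw [quotientFactorLeft_mk, Ideal.Quotient.eq_zero_iff_dvd]
  constructor
  · rintro ⟨c, rfl⟩
    exact ⟨Ideal.Quotient.mk _ c, rfl⟩
  · rintro ⟨x, hx⟩
    obtain ⟨c, rfl⟩ := Ideal.Quotient.mk_surjective x
    rw [quotientMulLeft_mk, Ideal.Quotient.mk_eq_mk_iff_sub_mem,
      Ideal.mem_span_singleton] at hx
    exact (dvd_sub_right (dvd_mul_right g c)).1 ((dvd_mul_right g f).trans hx)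

theorem ringHom_mk_eq_mk_expand {I J : Ideal ℤ[X]} {b : ℕ} {F : (ℤ[X] ⧸ I) →+* (ℤ[X] ⧸ J)}
    (hF : F (Ideal.Quotient.mk I X) = Ideal.Quotient.mk J (X ^ b)) (a : ℤ[X]) :
    F (Ideal.Quotient.mk I a) = Ideal.Quotient.mk J (expand ℤ b a) := by
  have : F.comp (Ideal.Quotient.mk I) =
      (Ideal.Quotient.mk J).comp (expand ℤ b : ℤ[X] →+* ℤ[X]) :=
    ringHom_ext' (RingHom.ext_int _ _) (by simpa using hF)
  exact RingHom.congr_fun this a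

theorem cyclotomic_dvd_expand {n b : ℕ} (hn : 0 < n) (hcop : b.Coprime n) :
    cyclotomic n ℤ ∣ expand ℤ b (cyclotomic n ℤ) := by
  have hζ := Complex.isPrimitiveRoot_exp n hn.ne'
  have : NeZero n := ⟨hn.ne'⟩
  nth_rw 1 [cyclotomic_eq_minpoly hζ hn]
  refine minpoly.isIntegrallyClosed_dvd (hζ.isIntegral hn) ?_
  have := (isRoot_cyclotomic_iff (R := ℂ)).2 (hζ.pow_of_coprime b hcop)
  rwa [IsRoot, ← map_cyclotomic_int, ← expand_eval, ← map_expand, eval_map,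
    ← algebraMap_int_eq, ← aeval_def] at this

theorem exists_ringHom_quotient_of_dvd_expand {f : ℤ[X]} {b : ℕ} (h : f ∣ expand ℤ b f) :
    ∃ F : (ℤ[X] ⧸ Ideal.span {f}) →+* (ℤ[X] ⧸ Ideal.span {f}),
      F (Ideal.Quotient.mk _ X) = Ideal.Quotient.mk _ (X ^ b) := by
  have hle : Ideal.span {f} ≤ (Ideal.span {f}).comap (expand ℤ b : ℤ[X] →+* ℤ[X]) := by
    rw [Ideal.span_singleton_le_iff_mem, Ideal.mem_comap, Ideal.mem_span_singleton]
    exact h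
  refine ⟨Ideal.quotientMap _ _ hle, ?_⟩
  rw [Ideal.quotientMap_mk]
  simp

theorem mk_X_pow_eq_one (n : ℕ) :
    (Ideal.Quotient.mk (Ideal.span {cyclotomic n ℤ}) X) ^ n = 1 := by
  rw [← map_pow, ← map_one (Ideal.Quotient.mk _), Ideal.Quotient.mk_eq_mk_iff_sub_mem,
    Ideal.mem_span_singleton]
  exact cyclotomic.dvd_X_pow_sub_one n ℤ

section

variable {n b : ℕ} {F : (ℤ[X] ⧸ Ideal.span {cyclotomic n ℤ}) →+*
  (ℤ[X] ⧸ Ideal.span {cyclotomic n ℤ})}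

theorem isUnit_det_of_map_mk_X (hn : 0 < n) (hcop : b.Coprime n)
    (hF : F (Ideal.Quotient.mk _ X) = Ideal.Quotient.mk _ (X ^ b)) :
    IsUnit F.toIntAlgHom.toLinearMap.det := by
  have hpow (m : ℕ) (a : ℤ[X]) : (F.toIntAlgHom.toLinearMap ^ m) (Ideal.Quotient.mk _ a) =
      Ideal.Quotient.mk _ (expand ℤ (b ^ m) a) := by
    induction m generalizing a with
    | zero => simp
    | succ m ih =>
      rw [pow_succ, Module.End.mul_apply]
      change (F.toIntAlgHom.toLinearMap ^ m) (F _) = _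
      rw [ringHom_mk_eq_mk_expand hF, ih, expand_expand, pow_succ]
  have hX : Ideal.Quotient.mk (Ideal.span {cyclotomic n ℤ}) (X ^ (b ^ n.totient)) =
      Ideal.Quotient.mk _ X := by
    rw [map_pow, pow_eq_pow_mod _ (mk_X_pow_eq_one n), Nat.ModEq.pow_totient hcop,
      ← pow_eq_pow_mod _ (mk_X_pow_eq_one n), pow_one]
  have hone : F.toIntAlgHom.toLinearMap ^ n.totient = 1 := by
    refine LinearMap.ext fun x ↦ ?_
    obtain ⟨a, rfl⟩ := Ideal.Quotient.mk_surjective x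
    rw [hpow]
    have := ringHom_mk_eq_mk_expand (F := RingHom.id (ℤ[X] ⧸ Ideal.span {cyclotomic n ℤ}))
      (b := b ^ n.totient) hX.symm a
    exact this.symm
  refine IsUnit.of_pow_eq_one (n := n.totient) ?_ (Nat.totient_pos.2 hn).ne'
  rw [← map_pow, hone, map_one]

theorem norm_map_eq (hn : 0 < n) (hcop : b.Coprime n)
    (hF : F (Ideal.Quotient.mk _ X) = Ideal.Quotient.mk _ (X ^ b))
    (x : ℤ[X] ⧸ Ideal.span {cyclotomic n ℤ}) :
    Algebra.norm ℤ (F x) = Algebra.norm ℤ x := by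
  refine mul_left_cancel₀ (isUnit_det_of_map_mk_X hn hcop hF).ne_zero ?_
  rw [Algebra.norm_apply, Algebra.norm_apply, mul_comm, ← LinearMap.det_comp,
    ← LinearMap.det_comp]
  congr 1
  exact LinearMap.ext fun y ↦ (map_mul F x y).symm

theorem natAbs_norm_eq_of_expand_eq_mul (hn : 0 < n) (hcop : b.Coprime n) {g : ℤ[X]}
    (hg : expand ℤ b (cyclotomic n ℤ) = cyclotomic n ℤ * g)
    (hF : F (Ideal.Quotient.mk _ X) = Ideal.Quotient.mk _ (X ^ b)) :
    (Algebra.norm ℤ (Ideal.Quotient.mk (Ideal.span {cyclotomic n ℤ}) g)).natAbs =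
      b ^ n.totient := by
  have hmonic := cyclotomic.monic n ℤ
  have := hmonic.free_quotient
  have := hmonic.finite_quotient
  have hprime : (Ideal.span {cyclotomic n ℤ}).IsPrime :=
    (Ideal.span_singleton_prime hmonic.ne_zero).2 (cyclotomic.irreducible hn).prime
  have hderiv : derivative (cyclotomic n ℤ) ≠ 0 := by
    intro h
    have := derivative_eq_zero.1 h
    rw [natDegree_cyclotomic] at this
    exact (Nat.totient_pos.2 hn).ne' this
  have hnorm : Algebra.norm ℤ
      (Ideal.Quotient.mk (Ideal.span {cyclotomic n ℤ}) (derivative (cyclotomic n ℤ))) ≠ 0 := by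
    rw [Algebra.norm_ne_zero_iff, Ne, Ideal.Quotient.eq_zero_iff_dvd]
    exact hmonic.not_dvd_of_degree_lt hderiv (degree_derivative_lt hmonic.ne_zero)
  have key : Ideal.Quotient.mk (Ideal.span {cyclotomic n ℤ}) (derivative (cyclotomic n ℤ)) *
      Ideal.Quotient.mk _ g = F (Ideal.Quotient.mk _ (derivative (cyclotomic n ℤ))) *
        ((b : ℤ[X] ⧸ Ideal.span {cyclotomic n ℤ}) * Ideal.Quotient.mk _ X ^ (b - 1)) := by
    have h := congrArg (Ideal.Quotient.mk (Ideal.span {cyclotomic n ℤ}))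
      (congrArg derivative hg)
    have h0 : Ideal.Quotient.mk (Ideal.span {cyclotomic n ℤ}) (cyclotomic n ℤ) = 0 :=
      (Ideal.Quotient.eq_zero_iff_dvd _ _).2 dvd_rfl
    rw [derivative_expand, derivative_mul, map_add, map_mul _ (cyclotomic n ℤ), h0, zero_mul,
      add_zero] at h
    rw [ringHom_mk_eq_mk_expand hF, ← map_mul, ← h]
    simp
  have hX : (Algebra.norm ℤ (Ideal.Quotient.mk (Ideal.span {cyclotomic n ℤ}) X)).natAbs = 1 :=
    Int.isUnit_iff_natAbs_eq.1
      ((IsUnit.of_pow_eq_one (mk_X_pow_eq_one n) hn.ne').map (Algebra.norm ℤ))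
  have h := congrArg Int.natAbs (congrArg (Algebra.norm ℤ) key)
  rw [map_mul, map_mul, map_mul, map_pow, norm_map_eq hn hcop hF, Algebra.norm_natCast,
    finrank_quotient_span_eq_natDegree' hmonic, natDegree_cyclotomic] at h
  simp only [Int.natAbs_mul, Int.natAbs_pow, hX, one_pow, mul_one, Int.natAbs_natCast] at h
  exact mul_left_cancel₀ (Int.natAbs_ne_zero.2 hnorm) h

end

theorem natAbs_det_eq_pow {n b : ℕ} (hn : 0 < n) (hcop : b.Coprime n) (k : ℕ)
    (F : (ℤ[X] ⧸ Ideal.span {cyclotomic n ℤ ^ k}) →+* (ℤ[X] ⧸ Ideal.span {cyclotomic n ℤ ^ k}))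
    (hF : F (Ideal.Quotient.mk _ X) = Ideal.Quotient.mk _ (X ^ b)) :
    F.toIntAlgHom.toLinearMap.det.natAbs = b ^ (n.totient * ∑ j ∈ Finset.range k, j) := by
  induction k with
  | zero =>
    have : Subsingleton (ℤ[X] ⧸ Ideal.span {cyclotomic n ℤ ^ 0}) := by
      rw [Ideal.Quotient.subsingleton_iff, pow_zero, Ideal.span_singleton_one]
    rw [LinearMap.det_eq_one_of_subsingleton]
    simp
  | succ k ih =>
    revert F
    rw [pow_succ (cyclotomic n ℤ) k]
    intro F hF
    have hdvd := cyclotomic_dvd_expand hn hcop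
    obtain ⟨H, hH⟩ := exists_ringHom_quotient_of_dvd_expand hdvd
    obtain ⟨G, hG⟩ := exists_ringHom_quotient_of_dvd_expand (f := cyclotomic n ℤ ^ k) (b := b)
      (by simpa using pow_dvd_pow_of_dvd hdvd k)
    obtain ⟨g, hg⟩ := hdvd
    have hmonic := cyclotomic.monic n ℤ
    have := hmonic.free_quotient
    have := hmonic.finite_quotient
    have := (hmonic.pow k).free_quotient
    have := ((hmonic.pow k).mul hmonic).finite_quotient
    have hdet : F.toIntAlgHom.toLinearMap.det =
        (LinearMap.mulLeft ℤ (Ideal.Quotient.mk (Ideal.span {cyclotomic n ℤ}) g ^ k) ∘ₗ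
          H.toIntAlgHom.toLinearMap).det * G.toIntAlgHom.toLinearMap.det := by
      refine LinearMap.det_eq_mul_of_exact
        (quotientMulLeft_injective (hmonic.pow k).ne_zero (cyclotomic n ℤ))
        (quotientFactorLeft_surjective _ _) (exact_quotientMulLeft_quotientFactorLeft _ _)
        ?_ ?_
      · refine LinearMap.ext fun x ↦ ?_
        obtain ⟨a, rfl⟩ := Ideal.Quotient.mk_surjective x
        change F (Ideal.Quotient.mk _ (cyclotomic n ℤ ^ k * a)) =
          quotientMulLeft (cyclotomic n ℤ ^ k) (cyclotomic n ℤ)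
            (Ideal.Quotient.mk _ g ^ k * H (Ideal.Quotient.mk _ a))
        rw [ringHom_mk_eq_mk_expand hF, ringHom_mk_eq_mk_expand hH, ← map_pow, ← map_mul,
          quotientMulLeft_mk, map_mul (expand ℤ b), map_pow (expand ℤ b), hg, mul_pow, mul_assoc]
      · refine LinearMap.ext fun x ↦ ?_
        obtain ⟨a, rfl⟩ := Ideal.Quotient.mk_surjective x
        change quotientFactorLeft (cyclotomic n ℤ ^ k) (cyclotomic n ℤ)
          (F (Ideal.Quotient.mk _ a)) = G (Ideal.Quotient.mk _ a)
        rw [ringHom_mk_eq_mk_expand hF, ringHom_mk_eq_mk_expand hG, quotientFactorLeft_mk]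
    have hmul : (LinearMap.mulLeft ℤ
        (Ideal.Quotient.mk (Ideal.span {cyclotomic n ℤ}) g ^ k)).det =
          Algebra.norm ℤ (Ideal.Quotient.mk (Ideal.span {cyclotomic n ℤ}) g) ^ k := by
      rw [← map_pow (Algebra.norm ℤ)]
      rfl
    rw [hdet, LinearMap.det_comp, hmul, Int.natAbs_mul, Int.natAbs_mul, Int.natAbs_pow,
      natAbs_norm_eq_of_expand_eq_mul hn hcop hg hH,
      Int.isUnit_iff_natAbs_eq.1 (isUnit_det_of_map_mk_X hn hcop hH), ih G hG,
      Finset.sum_range_succ]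
    ring

end Polynomial

theorem stmt_3 (n k b : ℕ) (hn : 0 < n) (hk : 0 < k) (hb : 0 < b)
    (hcop : Nat.Coprime b n)
    (F : (ℤ[X] ⧸ Ideal.span {(cyclotomic n ℤ) ^ k}) →+*
         (ℤ[X] ⧸ Ideal.span {(cyclotomic n ℤ) ^ k}))
    (hF : F (Ideal.Quotient.mk (Ideal.span {(cyclotomic n ℤ) ^ k}) X) =
          Ideal.Quotient.mk (Ideal.span {(cyclotomic n ℤ) ^ k}) (X ^ b)) :
    Module.Free ℤ (ℤ[X] ⧸ Ideal.span {(cyclotomic n ℤ) ^ k}) ∧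
    Module.finrank ℤ (ℤ[X] ⧸ Ideal.span {(cyclotomic n ℤ) ^ k}) = k * n.totient ∧
    Module.Free ℤ (LinearMap.range F.toIntAlgHom.toLinearMap) ∧
    Module.finrank ℤ (LinearMap.range F.toIntAlgHom.toLinearMap) = k * n.totient ∧
    (LinearMap.range F.toIntAlgHom.toLinearMap).toAddSubgroup.index =
      b ^ (k * (k - 1) * n.totient / 2) := by
  have hmonic := (cyclotomic.monic n ℤ).pow k
  have hfree := hmonic.free_quotient
  have hfin := hmonic.finite_quotient
  have hrank : Module.finrank ℤ (ℤ[X] ⧸ Ideal.span {(cyclotomic n ℤ) ^ k}) = k * n.totient := by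
    rw [finrank_quotient_span_eq_natDegree' hmonic, natDegree_pow, natDegree_cyclotomic]
  have hdet := natAbs_det_eq_pow hn hcop k F hF
  have hinj : Function.Injective F.toIntAlgHom.toLinearMap := by
    rw [← LinearMap.ker_eq_bot]
    by_contra h
    rw [← Ne, ← LinearMap.det_eq_zero_iff_ker_ne_bot] at h
    rw [h, Int.natAbs_zero] at hdet
    exact (pow_pos hb _).ne hdet
  have e := LinearEquiv.ofInjective _ hinj
  refine ⟨hfree, hrank, .of_equiv e, e.finrank_eq.symm.trans hrank, ?_⟩
  refine (LinearMap.index_range_eq_natAbs_det _ hinj).trans (hdet.trans ?_)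
  rw [Finset.sum_range_id, ← Nat.mul_div_assoc _ (Nat.even_mul_pred_self k).two_dvd, mul_comm]
end

section
/- Let b, n, k be positive integers with gcd(b, n) = 1. Then the Frobenius endomorphism F_b of the ring ℤ[1/b][q]/(Φ_n(q)^k) defined by F_b(q) = q^b is a ring isomorphism (i.e., bijective). -/
open Polynomial

/-- A surjective ring endomorphism of a Noetherian ring is injective. -/
theorem IsNoetherianRing.ringHom_injective_of_surjective {A : Type*} [CommRing A]
    [IsNoetherianRing A] (f : A →+* A) (hf : Function.Surjective f) :
    Function.Injective f := by
  have hmono : Monotone fun m : ℕ => RingHom.ker (f ^ m) :=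
    monotone_nat_of_le_succ fun m a ha => by
      rw [RingHom.mem_ker] at ha ⊢
      rw [pow_succ', RingHom.mul_def, RingHom.comp_apply, ha, map_zero]
  obtain ⟨m, hm⟩ := monotone_stabilizes_iff_noetherian.mpr ‹_› ⟨_, hmono⟩
  rw [injective_iff_map_eq_zero]
  intro a ha
  have hsurj : Function.Surjective (f ^ m : A →+* A) := by
    rw [RingHom.coe_pow]
    exact hf.iterate m
  obtain ⟨c, rfl⟩ := hsurj a
  have hc : c ∈ RingHom.ker (f ^ (m + 1)) := by
    rwa [RingHom.mem_ker, pow_succ', RingHom.mul_def, RingHom.comp_apply]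
  have key : RingHom.ker (f ^ m) = RingHom.ker (f ^ (m + 1)) := hm (m + 1) m.le_succ
  rwa [← key, RingHom.mem_ker] at hc

/-- If `x` is a unit, `b` is invertible and `x ^ (b * c) - x` is nilpotent, then `x` lies in the
range of any ring endomorphism sending `x` to `x ^ b`. -/
theorem exists_map_eq_of_isNilpotent_pow_sub {A : Type*} [CommRing A] (f : A →+* A) {x : A}
    {b c : ℕ} (hf : f x = x ^ b) (hx : IsUnit x) (hb : IsUnit (b : A))
    (hc : IsNilpotent (x ^ (b * c) - x)) : ∃ w, f w = x := by
  have hder (d y : A) : aeval y (derivative (X ^ b - C d : A[X])) = b * y ^ (b - 1) := by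
    rw [derivative_sub, derivative_C, sub_zero, derivative_X_pow]
    simp
  obtain ⟨w, ⟨hw, hwb⟩, -⟩ := existsUnique_nilpotent_sub_and_aeval_eq_zero
    (P := (X ^ b - C x : A[X])) (x := x ^ c)
    (by simpa [← pow_mul, mul_comm c b] using hc)
    (by rw [hder]; exact hb.mul ((hx.pow c).pow (b - 1)))
  have hwb' : w ^ b = x := by simpa [sub_eq_zero] using hwb
  refine ⟨w, (existsUnique_nilpotent_sub_and_aeval_eq_zero (P := (X ^ b - C (x ^ b) : A[X]))
    (x := x) (by simp) (by rw [hder]; exact hb.mul (hx.pow (b - 1)))).unique ⟨?_, ?_⟩ ⟨?_, ?_⟩⟩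
  · have h1 : IsNilpotent (f (x ^ c - w)) := hw.map f
    rw [map_sub, map_pow, hf, ← pow_mul] at h1
    have h2 := (Commute.all _ _).isNilpotent_sub h1 hc
    rwa [show x ^ (b * c) - f w - (x ^ (b * c) - x) = x - f w by ring] at h2
  · simp [← map_pow, hwb', hf]
  · simp
  · simp

theorem stmt_4 (b n k : ℕ) (hb : 0 < b) (hn : 0 < n) (hk : 0 < k)
    (hcop : Nat.Coprime b n)
    (R : Type) [CommRing R] [Algebra ℤ R] [IsLocalization.Away (b : ℤ) R]
    (F : (R[X] ⧸ Ideal.span {(cyclotomic n R) ^ k}) →+*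
         (R[X] ⧸ Ideal.span {(cyclotomic n R) ^ k}))
    (hF : F (Ideal.Quotient.mk (Ideal.span {(cyclotomic n R) ^ k}) X) =
          Ideal.Quotient.mk (Ideal.span {(cyclotomic n R) ^ k}) (X ^ b)) :
    Function.Bijective F := by
  have : IsNoetherianRing R :=
    IsLocalization.isNoetherianRing (Submonoid.powers (b : ℤ)) R inferInstance
  set π := Ideal.Quotient.mk (Ideal.span {(cyclotomic n R) ^ k}) with hπ
  have hnil {p : R[X]} (hp : cyclotomic n R ∣ p) : IsNilpotent (π p) :=
    ⟨k, by rw [← map_pow, hπ, Ideal.Quotient.eq_zero_iff_mem, Ideal.mem_span_singleton]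
           exact pow_dvd_pow_of_dvd hp k⟩
  have hdvd (m : ℕ) : cyclotomic n R ∣ X ^ (n * m) - 1 :=
    (cyclotomic.dvd_X_pow_sub_one n R).trans (by
      simpa [pow_mul] using sub_dvd_pow_sub_pow ((X : R[X]) ^ n) 1 m)
  have hX : IsUnit (π X) := by
    have h : IsUnit (π (X ^ n)) := by
      simpa using (hnil (cyclotomic.dvd_X_pow_sub_one n R)).isUnit_add_one
    rw [map_pow] at h
    exact (isUnit_pow_iff hn.ne').mp h
  have hbu : IsUnit (b : R[X] ⧸ Ideal.span {(cyclotomic n R) ^ k}) := by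
    simpa using (IsLocalization.Away.algebraMap_isUnit (S := R) (b : ℤ)).map (π.comp C)
  obtain ⟨c, m, hcm⟩ : ∃ c m, b * c = n * m + 1 := by
    have hmod : 1 ≡ b ^ n.totient [MOD n] := (Nat.ModEq.pow_totient hcop).symm
    have h1 : 1 ≤ b ^ n.totient := Nat.one_le_pow _ _ hb
    obtain ⟨m, hm⟩ := (Nat.modEq_iff_dvd' h1).mp hmod
    refine ⟨b ^ (n.totient - 1), m, ?_⟩
    rw [mul_pow_sub_one (Nat.totient_pos.mpr hn).ne']
    omega
  have hc : IsNilpotent (π X ^ (b * c) - π X) := by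
    have h := hnil ((hdvd m).mul_right X)
    rwa [sub_mul, one_mul, ← pow_succ, ← hcm, map_sub, map_pow] at h
  obtain ⟨w, hw⟩ := exists_map_eq_of_isNilpotent_pow_sub F (hF.trans (map_pow ..)) hX hbu hc
  have hC : F.comp (π.comp C) = π.comp C :=
    IsLocalization.ringHom_ext (Submonoid.powers (b : ℤ)) (RingHom.ext_int _ _)
  have hsurj : Function.Surjective F := by
    intro a
    obtain ⟨p, rfl⟩ := Ideal.Quotient.mk_surjective a
    refine ⟨p.eval₂ (π.comp C) w, ?_⟩
    rw [hom_eval₂, hC, hw, ← hom_eval₂, eval₂_C_X]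
  exact ⟨IsNoetherianRing.ringHom_injective_of_surjective F hsurj, hsurj⟩
end

section
/- Let n and b be coprime positive integers and let k ≥ 1. If y is an element of the quotient ring ℚ[X]/(Φ_n(X)^k) satisfying y^b = 1, then y = 1 or y = −1. Moreover, if b is odd, then y = 1. -/
open Polynomial

/-- A root of unity of order invertible in the ring is `1` as soon as it is unipotent. -/
theorem eq_one_of_pow_eq_one_of_isNilpotent_sub_one {R : Type*} [CommRing R] {y : R} {b : ℕ}
    (hb : IsUnit (b : R)) (hy : y ^ b = 1) (hnil : IsNilpotent (y - 1)) : y = 1 := by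
  have hdvd : y - 1 ∣ ∑ i ∈ Finset.range b, y ^ i - (b : R) := by
    have h : ∑ i ∈ Finset.range b, y ^ i - (b : R) = ∑ i ∈ Finset.range b, (y ^ i - 1) := by
      simp
    rw [h]
    exact Finset.dvd_sum fun i _ => sub_one_dvd_pow_sub_one y i
  obtain ⟨c, hc⟩ := hdvd
  have hunit : IsUnit (∑ i ∈ Finset.range b, y ^ i) := by
    rw [sub_eq_iff_eq_add.mp hc]
    exact ((Commute.all _ _).isNilpotent_mul_right hnil).isUnit_add_right_of_commute hb
      (Commute.all _ _)
  have hzero : (∑ i ∈ Finset.range b, y ^ i) * (y - 1) = 0 := by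
    rw [geom_sum_mul, hy, sub_self]
  exact sub_eq_zero.mp (hunit.mul_right_eq_zero.mp hzero)

/-- In the `n`-th cyclotomic field, a root of unity of order coprime to `n` is `1` or `-1`. -/
theorem IsCyclotomicExtension.eq_one_or_eq_neg_one_of_pow_eq_one {K : Type*} [Field K]
    [NumberField K] {n b : ℕ} [NeZero n] [IsCyclotomicExtension {n} ℚ K] (hb : 0 < b)
    (hcop : n.Coprime b) {x : K} (hx : x ^ b = 1) : x = 1 ∨ x = -1 := by
  have hdvd : orderOf x ∣ b := orderOf_dvd_of_pow_eq_one hx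
  have hdvd' : orderOf x ∣ 2 * n :=
    (IsPrimitiveRoot.orderOf x).dvd_of_isCyclotomicExtension n
      (Nat.pos_of_dvd_of_pos hdvd hb).ne'
  have htwo : orderOf x ∣ 2 :=
    (Nat.Coprime.coprime_dvd_right hdvd hcop).symm.dvd_of_dvd_mul_right hdvd'
  exact sq_eq_one_iff.mp (orderOf_dvd_iff_pow_eq_one.mp htwo)

theorem Polynomial.isNilpotent_mk_span_pow {R : Type*} [CommRing R] {f p : R[X]} (k : ℕ)
    (h : f ∣ p) : IsNilpotent (Ideal.Quotient.mk (Ideal.span {f ^ k}) p) :=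
  ⟨k, by
    rw [← map_pow, Ideal.Quotient.eq_zero_iff_mem, Ideal.mem_span_singleton]
    exact pow_dvd_pow_of_dvd h k⟩

theorem stmt_7 (n b k : ℕ) (hn : 0 < n) (hb : 0 < b) (hk : 1 ≤ k)
    (hcop : Nat.Coprime n b)
    (y : ℚ[X] ⧸ Ideal.span {(cyclotomic n ℚ) ^ k}) (hy : y ^ b = 1) :
    (y = 1 ∨ y = -1) ∧ (Odd b → y = 1) := by
  have hunit : ∀ m : ℕ, 0 < m →
      IsUnit (m : ℚ[X] ⧸ Ideal.span {(cyclotomic n ℚ) ^ k}) := fun m hm => by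
    simpa using (IsUnit.mk0 (m : ℚ) (by positivity)).map
      (algebraMap ℚ (ℚ[X] ⧸ Ideal.span {(cyclotomic n ℚ) ^ k}))
  have hmain : y = 1 ∨ y = -1 := by
    have : NeZero n := ⟨hn.ne'⟩
    have : IsCyclotomicExtension {n} ℚ (CyclotomicField n ℚ) :=
      CyclotomicField.isCyclotomicExtension n ℚ
    let ζ := IsCyclotomicExtension.zeta n ℚ (CyclotomicField n ℚ)
    have hζ : IsPrimitiveRoot ζ n := IsCyclotomicExtension.zeta_spec n ℚ (CyclotomicField n ℚ)
    have hΦ : cyclotomic n ℚ = minpoly ℚ ζ := cyclotomic_eq_minpoly_rat hζ hn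
    have hnil : ∀ q : ℚ[X], aeval ζ q = 0 →
        IsNilpotent (Ideal.Quotient.mk (Ideal.span {(cyclotomic n ℚ) ^ k}) q) := fun q hq =>
      isNilpotent_mk_span_pow k (hΦ ▸ minpoly.dvd ℚ ζ hq)
    obtain ⟨p, rfl⟩ := Ideal.Quotient.mk_surjective y
    have hp : aeval ζ p ^ b = 1 := by
      rw [← map_pow, ← map_one (Ideal.Quotient.mk _), Ideal.Quotient.mk_eq_mk_iff_sub_mem,
        Ideal.mem_span_singleton] at hy
      obtain ⟨c, hc⟩ := (dvd_pow_self _ (by omega : k ≠ 0)).trans hy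
      have h := congrArg (aeval ζ) hc
      rw [map_mul, hΦ, minpoly.aeval, zero_mul, map_sub, map_pow, map_one] at h
      exact sub_eq_zero.mp h
    have hp' := IsCyclotomicExtension.eq_one_or_eq_neg_one_of_pow_eq_one hb hcop hp
    have hsq : Ideal.Quotient.mk (Ideal.span {(cyclotomic n ℚ) ^ k}) p ^ 2 = 1 := by
      refine eq_one_of_pow_eq_one_of_isNilpotent_sub_one (hunit b hb)
        (by rw [pow_right_comm, hy, one_pow]) ?_
      have h := hnil (p ^ 2 - 1) (by rcases hp' with h | h <;> simp [h])
      simpa using h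
    refine hp'.imp (fun h => ?_) fun h => ?_
    · refine eq_one_of_pow_eq_one_of_isNilpotent_sub_one (hunit 2 two_pos) hsq ?_
      simpa using hnil (p - 1) (by simp [h])
    · refine neg_eq_iff_eq_neg.mp <|
        eq_one_of_pow_eq_one_of_isNilpotent_sub_one (hunit 2 two_pos) (by rw [neg_sq, hsq]) ?_
      simpa using hnil (-p - 1) (by simp [h])
  refine ⟨hmain, fun hodd => hmain.elim id fun h => ?_⟩
  obtain ⟨m, rfl⟩ := hodd
  have hsq : y ^ 2 = 1 := by rw [h]; ring
  rwa [pow_succ, pow_mul, hsq, one_pow, one_mul] at hy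
end

section
/- Let r be an odd positive integer, let ξ ∈ ℂ be a primitive r-th root of unity, and let b be an integer. Then the sum over odd n with 0 ≤ n ≤ 2r−1 of ξ^{b(n²−1)/4} (each exponent b(n²−1)/4 is an integer since n is odd) equals the generalized Gauss sum ∑_{m=0}^{r−1} ξ^{b(m²+m)}, and this quantity is nonzero. -/
open Finset

/-- The square modulus of the Gauss sum attached to `x ↦ x ^ 2 + x`, for an additive character `ψ`
of a finite commutative ring in which `2` is invertible. -/
theorem AddChar.sum_sq_add_self_mul_sum_neg {R K : Type*} [CommRing R] [Fintype R]
    [CommRing K] [IsDomain K] (h2 : IsUnit (2 : R)) (ψ : AddChar R K)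
    [DecidablePred fun t : R => ψ.mulShift (2 * t) = 1] :
    (∑ x, ψ (x ^ 2 + x)) * ∑ y, ψ (-(y ^ 2 + y)) =
      (#{t : R | ψ.mulShift (2 * t) = 1} : K) * (Fintype.card R : K) := by
  have hinner (t : R) : ∑ y, ψ ((t + y) ^ 2 + (t + y)) * ψ (-(y ^ 2 + y)) =
      if ψ.mulShift (2 * t) = 1 then (Fintype.card R : K) else 0 := by
    have hsum : ∑ y, ψ ((t + y) ^ 2 + (t + y)) * ψ (-(y ^ 2 + y)) =
        ψ (t ^ 2 + t) * ∑ y, ψ.mulShift (2 * t) y := by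
      rw [mul_sum]
      refine sum_congr rfl fun y _ => ?_
      rw [AddChar.mulShift_apply, ← AddChar.map_add_eq_mul, ← AddChar.map_add_eq_mul]
      congr 1
      ring
    rw [hsum]
    split_ifs with h
    · obtain ⟨c, hc⟩ := h2.exists_right_inv
      have h1 : ψ (t ^ 2 + t) = 1 := by
        have h' := DFunLike.congr_fun h (c * (t + 1))
        rw [AddChar.mulShift_apply, AddChar.one_apply] at h'
        rw [← h']
        congr 1
        linear_combination (-(t * (t + 1))) * hc
      rw [h1, one_mul, AddChar.sum_eq_card_of_eq_one h]
    · rw [AddChar.sum_eq_zero_of_ne_one h, mul_zero]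
  calc (∑ x, ψ (x ^ 2 + x)) * ∑ y, ψ (-(y ^ 2 + y))
      = ∑ y, ∑ x, ψ (x ^ 2 + x) * ψ (-(y ^ 2 + y)) := by
        rw [sum_mul_sum, sum_comm]
    _ = ∑ y, ∑ t, ψ ((t + y) ^ 2 + (t + y)) * ψ (-(y ^ 2 + y)) :=
        sum_congr rfl fun y _ => (Equiv.sum_comp (Equiv.addRight y)
          fun x => ψ (x ^ 2 + x) * ψ (-(y ^ 2 + y))).symm
    _ = _ := by
        rw [sum_comm, sum_congr rfl fun t _ => hinner t, ← sum_filter, sum_const, nsmul_eq_mul]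

theorem AddChar.sum_sq_add_self_ne_zero {R K : Type*} [CommRing R] [Fintype R]
    [CommRing K] [IsDomain K] [CharZero K] (h2 : IsUnit (2 : R)) (ψ : AddChar R K) :
    ∑ x, ψ (x ^ 2 + x) ≠ 0 := by
  classical
  intro h
  have key := AddChar.sum_sq_add_self_mul_sum_neg h2 ψ
  rw [h, zero_mul, eq_comm, mul_eq_zero, Nat.cast_eq_zero, Nat.cast_eq_zero] at key
  rcases key with h0 | h0
  · exact (card_ne_zero_of_mem (a := (0 : R)) (by simp)) h0
  · exact Fintype.card_ne_zero h0

theorem ZMod.sum_range_natCast {M : Type*} [AddCommMonoid M] (n : ℕ) [NeZero n]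
    (f : ZMod n → M) : ∑ m ∈ range n, f m = ∑ x, f x :=
  sum_nbij' (fun m => (m : ZMod n)) ZMod.val (by simp) (by simp [ZMod.val_lt])
    (fun m hm => ZMod.val_cast_of_lt (mem_range.mp hm)) (by simp) (by simp)

theorem Finset.sum_range_two_mul_filter_odd {M : Type*} [AddCommMonoid M] (r : ℕ) (f : ℕ → M) :
    ∑ n ∈ (range (2 * r)).filter (fun n => Odd n), f n = ∑ m ∈ range r, f (2 * m + 1) := by
  symm
  refine sum_nbij' (fun m => 2 * m + 1) (fun n => n / 2) (fun m hm => ?_) (fun n hn => ?_)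
    (fun m _ => ?_) (fun n hn => ?_) fun _ _ => rfl
  all_goals
    simp only [mem_filter, mem_range, Nat.odd_iff] at *
    omega

theorem stmt_8 (r : ℕ) (hr : Odd r) (hr0 : 0 < r) (ξ : ℂ)
    (hξ : IsPrimitiveRoot ξ r) (b : ℤ) :
    (∑ n ∈ (Finset.range (2 * r)).filter (fun n => Odd n),
        ξ ^ (b * (((n : ℤ) ^ 2 - 1) / 4)) =
      ∑ m ∈ Finset.range r, ξ ^ (b * ((m : ℤ) ^ 2 + (m : ℤ)))) ∧
    (∑ n ∈ (Finset.range (2 * r)).filter (fun n => Odd n),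
        ξ ^ (b * (((n : ℤ) ^ 2 - 1) / 4)) ≠ 0) := by
  have heq : ∑ n ∈ (Finset.range (2 * r)).filter (fun n => Odd n),
        ξ ^ (b * (((n : ℤ) ^ 2 - 1) / 4)) =
      ∑ m ∈ Finset.range r, ξ ^ (b * ((m : ℤ) ^ 2 + (m : ℤ))) := by
    rw [Finset.sum_range_two_mul_filter_odd]
    refine sum_congr rfl fun m _ => ?_
    have h4 : (((2 * m + 1 : ℕ) : ℤ) ^ 2 - 1) = 4 * ((m : ℤ) ^ 2 + m) := by
      push_cast
      ring
    rw [h4, Int.mul_ediv_cancel_left _ (by norm_num)]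
  refine ⟨heq, ?_⟩
  rw [heq]
  have : NeZero r := ⟨hr0.ne'⟩
  have hζ : (ξ ^ b) ^ r = 1 := by
    rw [← zpow_natCast, zpow_comm, zpow_natCast, hξ.pow_eq_one, one_zpow]
  have h2 : IsUnit (2 : ZMod r) := by
    simpa using (ZMod.isUnit_iff_coprime 2 r).mpr hr.coprime_two_left
  have hne := AddChar.sum_sq_add_self_ne_zero h2 (AddChar.zmodChar r hζ)
  rw [← ZMod.sum_range_natCast] at hne
  convert hne using 2 with m _
  have hm : ((m : ZMod r) ^ 2 + m) = ((m ^ 2 + m : ℕ) : ZMod r) := by push_cast; rfl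
  rw [hm, AddChar.zmodChar_apply', zpow_mul, ← zpow_natCast]
  push_cast
  rfl
end

section
/- Let r be a positive integer, let b be an integer, and set ζ = exp(2πi/(4r)) ∈ ℂ. Set c = gcd(b, r) (with the convention gcd(0,r)=r), r' = r/c and b' = b/c. Then ∑_{n=0}^{2r−1} ζ^{b(n²−1)} = 0 if and only if r' is odd and b' ≡ 2 (mod 4). In particular, for all other values of b and r this sum is nonzero. -/
open Finset

/-- The sum of a periodic function over a full period is invariant under translation. -/
theorem Function.Periodic.sum_range_add {M : Type*} [AddCommGroup M] {f : ℤ → M} {N : ℕ}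
    (hf : Function.Periodic f (N : ℤ)) (k : ℕ) :
    ∑ n ∈ range N, f (n + k) = ∑ n ∈ range N, f n := by
  induction k with
  | zero => simp
  | succ k ih =>
    rw [← ih]
    have h := (sum_range_succ (fun n : ℕ => f (n + k)) N).symm.trans
      (sum_range_succ' (fun n : ℕ => f (n + k)) N)
    have hN : f ((N : ℤ) + k) = f (((0 : ℕ) : ℤ) + k) := by
      rw [add_comm, hf, Nat.cast_zero, zero_add]
    rw [hN] at h
    rw [add_right_cancel h]
    refine sum_congr rfl fun n _ => congrArg f ?_
    push_cast
    ring

namespace IsPrimitiveRoot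

variable {K : Type*} [Field K] {ζ : K} {r : ℕ}

theorem zpow_eq_zpow_of_dvd_sub {k : ℕ} (h : IsPrimitiveRoot ζ k) (hk : 0 < k) {a b : ℤ}
    (hab : (k : ℤ) ∣ a - b) : ζ ^ a = ζ ^ b := by
  rw [← sub_add_cancel a b, zpow_add₀ (h.ne_zero hk.ne'), (h.zpow_eq_one_iff_dvd _).2 hab, one_mul]

theorem periodic_zpow_mul_sq (h : IsPrimitiveRoot ζ (4 * r)) (hr : 0 < r) (b : ℤ) :
    Function.Periodic (fun n : ℤ => ζ ^ (b * n ^ 2)) ((2 * r : ℕ) : ℤ) := fun n =>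
  h.zpow_eq_zpow_of_dvd_sub (by positivity) ⟨b * (n + r), by push_cast; ring⟩

theorem sum_range_zpow_mul (h : IsPrimitiveRoot ζ (4 * r)) (a : ℤ) :
    ∑ m ∈ range (2 * r), ζ ^ (2 * a * m) =
      if ((2 * r : ℕ) : ℤ) ∣ a then ((2 * r : ℕ) : K) else 0 := by
  have hpow : ∀ m : ℕ, ζ ^ (2 * a * m) = (ζ ^ (2 * a)) ^ m := fun m => by
    rw [zpow_mul, zpow_natCast]
  have hiff : ζ ^ (2 * a) = 1 ↔ ((2 * r : ℕ) : ℤ) ∣ a := by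
    rw [h.zpow_eq_one_iff_dvd,
      ← mul_dvd_mul_iff_left (two_ne_zero (α := ℤ)) (b := ((2 * r : ℕ) : ℤ))]
    push_cast
    ring_nf
  simp_rw [hpow]
  split_ifs with ha
  · simp [hiff.2 ha]
  · have h1 : ζ ^ (2 * a) - 1 ≠ 0 := sub_ne_zero.2 (mt hiff.1 ha)
    refine (mul_eq_zero.1 ((geom_sum_mul (ζ ^ (2 * a)) (2 * r)).trans ?_)).resolve_right h1
    rw [← hpow, sub_eq_zero, h.zpow_eq_one_iff_dvd]
    exact ⟨a, by push_cast; ring⟩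

/-- The product of a quadratic Gauss sum with its conjugate, as a sum over the kernel of the
associated bilinear form. -/
theorem gaussSum_mul_gaussSum_neg (h : IsPrimitiveRoot ζ (4 * r)) (hr : 0 < r) (b : ℤ) :
    (∑ n ∈ range (2 * r), ζ ^ (b * (n : ℤ) ^ 2)) * ∑ m ∈ range (2 * r), ζ ^ (-(b * (m : ℤ) ^ 2)) =
      (2 * r : ℕ) * ∑ k ∈ range (2 * r) with ((2 * r : ℕ) : ℤ) ∣ b * (k : ℕ),
        ζ ^ (b * (k : ℤ) ^ 2) := by
  have h0 : ζ ≠ 0 := h.ne_zero (by positivity)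
  calc
    _ = ∑ m ∈ range (2 * r), ∑ k ∈ range (2 * r),
          ζ ^ (b * ((k : ℤ) + m) ^ 2) * ζ ^ (-(b * (m : ℤ) ^ 2)) := by
      rw [mul_sum]
      refine sum_congr rfl fun m _ => ?_
      rw [← sum_mul, (h.periodic_zpow_mul_sq hr b).sum_range_add m]
    _ = ∑ k ∈ range (2 * r), ζ ^ (b * (k : ℤ) ^ 2) *
          ∑ m ∈ range (2 * r), ζ ^ (2 * (b * (k : ℤ)) * m) := by
      rw [sum_comm]
      refine sum_congr rfl fun k _ => ?_
      rw [mul_sum]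
      refine sum_congr rfl fun m _ => ?_
      rw [← zpow_add₀ h0, ← zpow_add₀ h0]
      ring_nf
    _ = _ := by
      simp_rw [h.sum_range_zpow_mul]
      rw [sum_filter, mul_sum]
      refine sum_congr rfl fun k _ => ?_
      split_ifs
      · ring
      · simp

theorem gaussSum_ne_zero [CharZero K] (h : IsPrimitiveRoot ζ (4 * r)) (hr : 0 < r) {b : ℤ}
    (hb : ∀ k : ℤ, 2 * (r : ℤ) ∣ b * k → 4 * (r : ℤ) ∣ b * k ^ 2) :
    ∑ n ∈ range (2 * r), ζ ^ (b * (n : ℤ) ^ 2) ≠ 0 := by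
  refine left_ne_zero_of_mul (b := ∑ m ∈ range (2 * r), ζ ^ (-(b * (m : ℤ) ^ 2))) ?_
  rw [h.gaussSum_mul_gaussSum_neg hr b, sum_congr rfl (g := fun _ => (1 : K)), sum_const,
    nsmul_one, ← Nat.cast_mul, Nat.cast_ne_zero]
  · refine mul_ne_zero (by positivity) (card_ne_zero_of_mem (a := 0) ?_)
    simpa using hr
  · intro k hk
    rw [h.zpow_eq_one_iff_dvd]
    exact_mod_cast hb k (by exact_mod_cast (mem_filter.1 hk).2)

theorem gaussSum_eq_zero [CharZero K] (h : IsPrimitiveRoot ζ (4 * r)) (hr : 0 < r) {b : ℤ} {s : ℕ}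
    (hs : ∀ n : ℤ, 4 * (r : ℤ) ∣ b * (n + s) ^ 2 - (b * n ^ 2 + 2 * r)) :
    ∑ n ∈ range (2 * r), ζ ^ (b * (n : ℤ) ^ 2) = 0 := by
  have h2 : ζ ^ (2 * (r : ℤ)) = -1 := by
    have h4 : (ζ ^ (2 * (r : ℤ))) ^ 2 = 1 := by
      rw [← zpow_natCast, ← zpow_mul, h.zpow_eq_one_iff_dvd]
      exact ⟨1, by push_cast; ring⟩
    refine (mul_self_eq_one_iff.1 ((sq _).symm.trans h4)).resolve_left fun h1 => ?_
    have := Int.le_of_dvd (by positivity) ((h.zpow_eq_one_iff_dvd _).1 h1)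
    push_cast at this
    lia
  rw [← self_eq_neg, ← sum_neg_distrib, ← (h.periodic_zpow_mul_sq hr b).sum_range_add s]
  refine sum_congr rfl fun n _ => ?_
  rw [h.zpow_eq_zpow_of_dvd_sub (b := b * (n : ℤ) ^ 2 + 2 * r) (by positivity)
      (by simpa using hs n),
    zpow_add₀ (h.ne_zero (by positivity)), h2, mul_neg_one]

end IsPrimitiveRoot

theorem stmt_9 (r : ℕ) (hr : 0 < r) (b : ℤ) :
    (∑ n ∈ Finset.range (2 * r),
        Complex.exp (2 * (Real.pi : ℂ) * Complex.I / (4 * r)) ^ (b * ((n : ℤ) ^ 2 - 1)) = 0) ↔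
      (Odd (r / Int.gcd b r) ∧ (b / (Int.gcd b r : ℤ)) % 4 = 2) := by
  have hζ : IsPrimitiveRoot (Complex.exp (2 * (Real.pi : ℂ) * Complex.I / (4 * r))) (4 * r) := by
    simpa using Complex.isPrimitiveRoot_exp (4 * r) (by positivity)
  generalize Complex.exp (2 * (Real.pi : ℂ) * Complex.I / (4 * r)) = ζ at hζ
  have h0 : ζ ≠ 0 := hζ.ne_zero (by positivity)
  have hsum : ∑ n ∈ range (2 * r), ζ ^ (b * ((n : ℤ) ^ 2 - 1)) =
      (∑ n ∈ range (2 * r), ζ ^ (b * (n : ℤ) ^ 2)) * ζ ^ (-b) := by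
    rw [sum_mul]
    refine sum_congr rfl fun n _ => ?_
    rw [← zpow_add₀ h0]
    ring_nf
  rw [hsum, mul_eq_zero_iff_right (zpow_ne_zero _ h0)]
  have hc : 0 < Int.gcd b r := Int.gcd_pos_of_ne_zero_right _ (by exact_mod_cast hr.ne')
  have hcop : IsCoprime (b / (Int.gcd b r : ℤ)) ((r / Int.gcd b r : ℕ) : ℤ) := by
    rw [Int.isCoprime_iff_gcd_eq_one, Int.natCast_div]
    exact Int.gcd_div_gcd_div_gcd hc
  have hbc : b = Int.gcd b r * (b / (Int.gcd b r : ℤ)) :=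
    (Int.mul_ediv_cancel' (Int.gcd_dvd_left _ _)).symm
  have hrc : r = Int.gcd b r * (r / Int.gcd b r) :=
    (Nat.mul_div_cancel' (by exact_mod_cast Int.gcd_dvd_right b r)).symm
  generalize b / (Int.gcd b r : ℤ) = b' at *
  generalize r / Int.gcd b r = r' at *
  generalize Int.gcd b r = c at *
  have hrc' : (r : ℤ) = c * r' := by exact_mod_cast hrc
  have hcZ : (c : ℤ) ≠ 0 := by exact_mod_cast hc.ne'
  constructor
  · contrapose!
    intro hcond
    refine hζ.gaussSum_ne_zero hr fun k hk => ?_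
    rw [hbc, hrc'] at hk ⊢
    have hk' : 2 * (r' : ℤ) ∣ b' * k :=
      (mul_dvd_mul_iff_left hcZ).1 (by rwa [mul_left_comm, ← mul_assoc (c : ℤ) b'])
    suffices 4 * (r' : ℤ) ∣ b' * k ^ 2 by
      rw [mul_left_comm, mul_assoc]
      exact mul_dvd_mul_left _ this
    obtain ⟨l, rfl⟩ : (r' : ℤ) ∣ k := hcop.symm.dvd_of_dvd_mul_left ((dvd_mul_left _ _).trans hk')
    have hr' : (r' : ℤ) ≠ 0 := by
      rintro h
      rw [h, mul_zero] at hrc'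
      lia
    have hl : 2 ∣ b' * l :=
      (mul_dvd_mul_iff_right hr').1 (by rwa [mul_assoc, mul_comm l])
    suffices 4 ∣ b' * l ^ 2 by
      rw [mul_pow, mul_left_comm, mul_comm 4]
      exact mul_dvd_mul (dvd_pow_self _ two_ne_zero) this
    rcases Int.even_or_odd b' with hb | hb
    · suffices 4 ∣ b' from this.mul_right _
      have hodd : Odd r' := by
        rw [← Nat.not_even_iff_odd]
        intro he
        have := hcop.isUnit_of_dvd' hb.two_dvd (by exact_mod_cast he.two_dvd)
        revert this
        decide
      have := hcond hodd
      have := hb.two_dvd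
      lia
    · obtain ⟨q, rfl⟩ : 2 ∣ l := (Int.prime_two.dvd_or_dvd hl).resolve_left (by
        rw [← even_iff_two_dvd]
        exact Int.not_even_iff_odd.2 hb)
      exact ⟨b' * q ^ 2, by ring⟩
  · rintro ⟨⟨q, hq⟩, hb⟩
    obtain ⟨t, rfl⟩ : ∃ t, b' = 4 * t + 2 := ⟨b' / 4, by lia⟩
    refine hζ.gaussSum_eq_zero hr (s := r') fun n => ?_
    have hq' : (r' : ℤ) = 2 * q + 1 := by exact_mod_cast hq
    refine ⟨(2 * t + 1) * n + t * r' + q, ?_⟩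
    rw [hbc, hrc', hq']
    ring
end

section
/- Let b be a positive integer and a an integer coprime to b. Then 3·s(1,b) − 3·s(a,b) lies in (1/b)·ℤ, i.e., b·(3·s(1,b) − 3·s(a,b)) is an integer. -/
open Finset

/-- The sawtooth function `((x))`: `x - ⌊x⌋ - 1/2` for non-integral `x`, and `0` for
integral `x`. -/
noncomputable def sawtooth (x : ℝ) : ℝ :=
  open Classical in if ∃ m : ℤ, x = (m : ℝ) then 0 else x - ⌊x⌋ - 1 / 2

/-- The Dedekind sum `s(a,b) = ∑_{n=0}^{b-1} ((n/b)) ((an/b))`. -/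
noncomputable def dedekindSum (a : ℤ) (b : ℕ) : ℝ :=
  ∑ n ∈ Finset.range b, sawtooth ((n : ℝ) / b) * sawtooth ((a : ℝ) * n / b)

/-- The sawtooth function at a rational number that is not an integer. -/
theorem sawtooth_intCast_div {b : ℕ} (hb : 0 < b) {k : ℤ} (hk : ¬ (b : ℤ) ∣ k) :
    sawtooth ((k : ℝ) / b) = ((k % b : ℤ) : ℝ) / b - 1 / 2 := by
  have hb' : (b : ℝ) ≠ 0 := by positivity
  have hnot : ¬ ∃ m : ℤ, (k : ℝ) / b = (m : ℝ) := by
    rintro ⟨m, hm⟩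
    rw [div_eq_iff hb'] at hm
    exact hk ⟨m, by rw [mul_comm]; exact_mod_cast hm⟩
  have hfloor : ⌊(k : ℝ) / b⌋ = k / (b : ℤ) := by
    rw [Int.floor_div_natCast, Int.floor_intCast]
  rw [sawtooth, if_neg hnot, hfloor, Int.emod_def]
  push_cast
  field_simp

theorem not_dvd_mul_succ {a : ℤ} {c n : ℕ} (hcop : IsCoprime a ((c + 1 : ℕ) : ℤ)) (hn : n < c) :
    ¬ ((c + 1 : ℕ) : ℤ) ∣ a * (n + 1) := by
  intro h
  have := Int.le_of_dvd (by positivity) (hcop.symm.dvd_of_dvd_mul_left h)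
  push_cast at this
  omega

theorem one_mul_succ_emod {c n : ℕ} (hn : n < c) :
    1 * ((n : ℤ) + 1) % ((c + 1 : ℕ) : ℤ) = n + 1 := by
  rw [one_mul]
  exact Int.emod_eq_of_lt (by positivity) (by push_cast; omega)

/-- The Dedekind sum in terms of least non-negative residues. -/
theorem dedekindSum_succ_eq {a : ℤ} {c : ℕ} (hcop : IsCoprime a ((c + 1 : ℕ) : ℤ)) :
    dedekindSum a (c + 1) = ∑ n ∈ range c, (((n : ℝ) + 1) / (c + 1 : ℕ) - 1 / 2) *
      (((a * (n + 1) % (c + 1 : ℕ) : ℤ) : ℝ) / (c + 1 : ℕ) - 1 / 2) := by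
  have h0 : sawtooth 0 = 0 := if_pos ⟨0, by simp⟩
  rw [dedekindSum, sum_range_succ']
  simp only [Nat.cast_zero, zero_div, h0, zero_mul, add_zero]
  refine sum_congr rfl fun n hn => ?_
  have hn := mem_range.mp hn
  have h1 := sawtooth_intCast_div c.succ_pos (not_dvd_mul_succ isCoprime_one_left hn)
  have h2 := sawtooth_intCast_div c.succ_pos (not_dvd_mul_succ hcop hn)
  rw [Nat.succ_eq_add_one, one_mul_succ_emod hn] at h1
  rw [Nat.succ_eq_add_one] at h2
  rw [← h2]
  push_cast at h1 ⊢
  rw [← h1, one_mul]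

theorem two_mul_sum_emod {a : ℤ} {c : ℕ} (hcop : IsCoprime a ((c + 1 : ℕ) : ℤ)) :
    2 * ∑ n ∈ range c, a * (n + 1) % ((c + 1 : ℕ) : ℤ) = c * (c + 1) := by
  have hpair : ∀ n ∈ range c, a * (n + 1) % ((c + 1 : ℕ) : ℤ) +
      a * ((c - 1 - n : ℕ) + 1) % ((c + 1 : ℕ) : ℤ) = c + 1 := by
    intro n hn
    have hn := mem_range.mp hn
    have hcast : a * (((c - 1 - n : ℕ) : ℤ) + 1) = -(a * (n + 1)) + ((c + 1 : ℕ) : ℤ) * a := by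
      have : ((c - 1 - n : ℕ) : ℤ) = c - 1 - n := by omega
      rw [this]; push_cast; ring
    rw [hcast, Int.add_mul_emod_self_left, Int.neg_emod, if_neg (not_dvd_mul_succ hcop hn)]
    push_cast
    rw [abs_of_nonneg (by positivity), add_sub_cancel]
  have hsum := sum_congr rfl hpair
  rw [sum_add_distrib, sum_range_reflect (fun n : ℕ => a * ((n : ℤ) + 1) % ((c + 1 : ℕ) : ℤ)) c] at hsum
  rw [two_mul, hsum]
  simp

theorem six_mul_sum_succ_sq (c : ℕ) :
    6 * ∑ n ∈ range c, ((n : ℤ) + 1) ^ 2 = (c : ℤ) * (c + 1) * (2 * c + 1) := by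
  induction c with
  | zero => simp
  | succ c ih => rw [sum_range_succ, mul_add, ih]; push_cast; ring

theorem even_one_sub_mul {a : ℤ} {c : ℕ} (hcop : IsCoprime a ((c + 1 : ℕ) : ℤ)) :
    Even ((1 - a) * c) := by
  rcases Int.even_or_odd (c : ℤ) with hc | hc
  · exact hc.mul_left _
  · refine Even.mul_right ?_ _
    rcases Int.even_or_odd a with ha | ha
    · have h2 : (2 : ℤ) ∣ ((c + 1 : ℕ) : ℤ) := by
        push_cast
        exact hc.add_one.two_dvd
      exact absurd (hcop.isUnit_of_dvd' ha.two_dvd h2) (by decide)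
    · exact odd_one.sub_odd ha

theorem dvd_three_mul_sum {a : ℤ} {c : ℕ} (hcop : IsCoprime a ((c + 1 : ℕ) : ℤ)) :
    ((c + 1 : ℕ) : ℤ) ∣
      3 * ∑ n ∈ range c, ((n : ℤ) + 1) * ((n + 1) - a * (n + 1) % ((c + 1 : ℕ) : ℤ)) := by
  obtain ⟨k, hk⟩ := even_one_sub_mul hcop
  have hsq := six_mul_sum_succ_sq c
  have hsplit : ∑ n ∈ range c, ((n : ℤ) + 1) * ((n + 1) - a * (n + 1) % ((c + 1 : ℕ) : ℤ)) =
      (1 - a) * ∑ n ∈ range c, ((n : ℤ) + 1) ^ 2 + ((c + 1 : ℕ) : ℤ) *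
        ∑ n ∈ range c, ((n : ℤ) + 1) * (a * (n + 1) / ((c + 1 : ℕ) : ℤ)) := by
    rw [mul_sum, mul_sum, ← sum_add_distrib]
    refine sum_congr rfl fun n _ => ?_
    rw [Int.emod_def]
    ring
  have hmain : 3 * ((1 - a) * ∑ n ∈ range c, ((n : ℤ) + 1) ^ 2) =
      ((c + 1 : ℕ) : ℤ) * (k * (2 * c + 1)) := by
    push_cast
    refine mul_left_cancel₀ (two_ne_zero' ℤ) ?_
    linear_combination (1 - a) * hsq + ((c : ℤ) + 1) * (2 * c + 1) * hk
  rw [hsplit, mul_add, hmain]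
  exact dvd_add (dvd_mul_right _ _) ((dvd_mul_right _ _).mul_left _)

theorem stmt_11 (b : ℕ) (hb : 0 < b) (a : ℤ) (hcop : Int.gcd a b = 1) :
    ∃ m : ℤ, (b : ℝ) * (3 * dedekindSum 1 b - 3 * dedekindSum a b) = (m : ℝ) := by
  obtain ⟨c, rfl⟩ := Nat.exists_eq_add_one.mpr hb
  have hcop := Int.isCoprime_iff_gcd_eq_one.mpr hcop
  obtain ⟨m, hm⟩ := dvd_three_mul_sum hcop
  have hzero : ∑ n ∈ range c, (((n : ℤ) + 1) - a * (n + 1) % ((c + 1 : ℕ) : ℤ)) = 0 := by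
    have h1 := two_mul_sum_emod (a := 1) (c := c) isCoprime_one_left
    have h2 := two_mul_sum_emod hcop
    have h3 : ∑ n ∈ range c, 1 * ((n : ℤ) + 1) % ((c + 1 : ℕ) : ℤ) =
        ∑ n ∈ range c, ((n : ℤ) + 1) :=
      sum_congr rfl fun n hn => one_mul_succ_emod (mem_range.mp hn)
    rw [sum_sub_distrib]
    linarith
  refine ⟨m, ?_⟩
  have hb' : ((c + 1 : ℕ) : ℝ) ≠ 0 := by positivity
  have hmR := congrArg (Int.cast : ℤ → ℝ) hm
  rw [dedekindSum_succ_eq isCoprime_one_left, dedekindSum_succ_eq hcop, ← mul_sub,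
    ← sum_sub_distrib]
  have hterm : ∀ n ∈ range c,
      (((n : ℝ) + 1) / (c + 1 : ℕ) - 1 / 2) *
        (((1 * (n + 1) % (c + 1 : ℕ) : ℤ) : ℝ) / (c + 1 : ℕ) - 1 / 2) -
      (((n : ℝ) + 1) / (c + 1 : ℕ) - 1 / 2) *
        (((a * (n + 1) % (c + 1 : ℕ) : ℤ) : ℝ) / (c + 1 : ℕ) - 1 / 2) =
      ((((n : ℤ) + 1) * ((n + 1) - a * (n + 1) % ((c + 1 : ℕ) : ℤ)) : ℤ) : ℝ) /
        ((c + 1 : ℕ) : ℝ) ^ 2 -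
      ((((n : ℤ) + 1) - a * (n + 1) % ((c + 1 : ℕ) : ℤ) : ℤ) : ℝ) / (2 * (c + 1 : ℕ)) := by
    intro n hn
    rw [one_mul_succ_emod (mem_range.mp hn)]
    generalize a * ((n : ℤ) + 1) % ((c + 1 : ℕ) : ℤ) = r
    push_cast at hb' ⊢
    field_simp
    ring
  rw [sum_congr rfl hterm, sum_sub_distrib, ← sum_div, ← sum_div, ← Int.cast_sum, ← Int.cast_sum,
    hzero, Int.cast_zero, zero_div, sub_zero]
  rw [Int.cast_mul, Int.cast_mul, Int.cast_natCast, Int.cast_ofNat] at hmR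
  field_simp
  linear_combination hmR
end

section
/- Let r ≥ 1 and n ≥ 1 be integers and let m₁, …, m_n be integers with m_i ≥ 2 for all i. Define p₀ = 1, p₁ = m₁, and p_{i+1} = m_{i+1}·p_i − p_{i−1} for 1 ≤ i < n, and set b = p_n, a = p_{n−1} (then b > a ≥ 1 and gcd(a,b) = 1). Let a* be the unique integer with 0 < a* ≤ b and a·a* ≡ 1 (mod b), and set b° = (1 − a·a*)/b ∈ ℤ. Write e(x) = exp(2πi·x) for x ∈ ℚ. For an integer d, define S_n(d) = ∑_{j₁,…,j_n = 0}^{2r−1} e((∑_{i=1}^{n} m_i j_i²)/(4r)) · (e(j₁/(2r)) − e(−j₁/(2r))) · ∏_{i=1}^{n−1} (e(j_i j_{i+1}/(2r)) − e(−j_i j_{i+1}/(2r))) · (e(j_n d/(2r)) − e(−j_n d/(2r))). Then for every integer d: S_n(d) = (−2(1+i)√r)^n · (1/√b) · e(b°/(4ar)) · ∑_{γ = 0, γ ≡ d (mod 2r)}^{2rb−1} ( e(−(aγ−1)²/(4abr)) − e(−(aγ+1)²/(4abr)) ). -/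
open Finset

/-- `e(x) = exp(2 π i x)` for a rational number `x`. -/
noncomputable def eRat (x : ℚ) : ℂ := Complex.exp (2 * (Real.pi : ℂ) * Complex.I * (x : ℂ))

/-- The denominators `p_i` of the continued fraction
`b/a = m_n - 1/(m_{n-1} - 1/(⋯ - 1/m₁))`:
`p₀ = 1`, `p₁ = m₁`, `p_{i+2} = m_{i+2} p_{i+1} - p_i`. -/
def contDenom (m : ℕ → ℤ) : ℕ → ℤ
  | 0 => 1
  | 1 => m 1
  | (i + 2) => m (i + 2) * contDenom m (i + 1) - contDenom m i

/-- The sum `S_n(d)` associated to the Hopf-chain surgery presentation of a lens space: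
`S_n(d) = ∑_{j₁,…,j_n = 0}^{2r−1} e((∑ m_i j_i²)/(4r)) (e(j₁/(2r)) − e(−j₁/(2r)))
  ∏_{i=1}^{n−1} (e(j_i j_{i+1}/(2r)) − e(−j_i j_{i+1}/(2r)))
  (e(j_n d/(2r)) − e(−j_n d/(2r)))`,
where the variable `j i` (for `i : Fin n`) plays the role of `j_{i+1}`. -/
noncomputable def Ssum (r n : ℕ) (m : ℕ → ℤ) (d : ℤ) : ℂ :=
  ∑ j ∈ Fintype.piFinset (fun _ : Fin n => Finset.range (2 * r)),
    (fun J : ℕ → ℤ =>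
      eRat (((∑ i ∈ Finset.range n, m (i + 1) * (J i) ^ 2 : ℤ) : ℚ) / (4 * (r : ℚ))) *
        (eRat ((J 0 : ℚ) / (2 * (r : ℚ))) - eRat (-(J 0 : ℚ) / (2 * (r : ℚ)))) *
        (∏ i ∈ Finset.range (n - 1),
          (eRat (((J i * J (i + 1) : ℤ) : ℚ) / (2 * (r : ℚ))) -
            eRat (-((J i * J (i + 1) : ℤ) : ℚ) / (2 * (r : ℚ))))) *
        (eRat (((J (n - 1) * d : ℤ) : ℚ) / (2 * (r : ℚ))) -
          eRat (-((J (n - 1) * d : ℤ) : ℚ) / (2 * (r : ℚ)))))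
      (fun i => if h : i < n then (j ⟨i, h⟩ : ℤ) else 0)

theorem eRat_add (x y : ℚ) : eRat (x + y) = eRat x * eRat y := by
  rw [eRat, eRat, eRat, ← Complex.exp_add]
  congr 1
  push_cast
  ring

theorem eRat_intCast (n : ℤ) : eRat n = 1 := by
  rw [eRat, Complex.exp_eq_one_iff]
  exact ⟨n, by push_cast; ring⟩

theorem eRat_congr {x y : ℚ} (n : ℤ) (h : x = y + n) : eRat x = eRat y := by
  rw [h, eRat_add, eRat_intCast, mul_one]

theorem norm_eRat (x : ℚ) : ‖eRat x‖ = 1 := by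
  rw [eRat, show 2 * (Real.pi : ℂ) * Complex.I * (x : ℂ) =
    ((2 * Real.pi * (x : ℝ) : ℝ) : ℂ) * Complex.I by push_cast; ring]
  exact Complex.norm_exp_ofReal_mul_I _

open Filter Topology in
/-- The normalised Gaussian sum `u^(-1/2) ∑ exp (-π (q + α)² / u)` tends to `1` as
`Re u → ∞`. -/
theorem tendsto_gaussian_tsum {ι : Type*} {l : Filter ι} {u : ι → ℂ}
    (hu : Tendsto (fun t => (u t).re) l atTop) (α : ℝ) :
    Tendsto (fun t => 1 / (u t) ^ (1 / 2 : ℂ) *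
      ∑' q : ℤ, Complex.exp (-Real.pi / u t * ((q : ℂ) + α) ^ 2)) l (𝓝 1) := by
  have h1 : Tendsto (fun t => ∑' n : ℤ, Complex.exp
      (-Real.pi * u t * (n : ℂ) ^ 2 + 2 * Real.pi * (-Complex.I * α) * n)) l
      (𝓝 (∑' n : ℤ, if n = 0 then (1 : ℂ) else 0)) := by
    have hnorm : ∀ (n : ℤ) t, ‖Complex.exp
        (-Real.pi * u t * (n : ℂ) ^ 2 + 2 * Real.pi * (-Complex.I * α) * n)‖ =
        Real.exp (-Real.pi * (n : ℝ) ^ 2 * (u t).re) := by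
      intro n t
      have e1 : (-Real.pi * u t * (n : ℂ) ^ 2 + 2 * Real.pi * (-Complex.I * α) * n) =
          ((-Real.pi * (n : ℝ) ^ 2 : ℝ) : ℂ) * u t + ((-2 * Real.pi * α * n : ℝ) : ℂ) * Complex.I := by
        push_cast; ring
      rw [Complex.norm_exp, e1, Complex.add_re, Complex.re_ofReal_mul, Complex.re_ofReal_mul,
        Complex.I_re, mul_zero, add_zero]
    have hs := summable_pow_mul_jacobiTheta₂_term_bound 0 one_pos 0
    refine tendsto_tsum_of_dominated_convergence hs ?_ ?_
    · intro n
      by_cases hn : n = 0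
      · simpa [hn] using tendsto_const_nhds
      · rw [if_neg hn, tendsto_zero_iff_norm_tendsto_zero]
        simp_rw [hnorm]
        refine Real.tendsto_exp_atBot.comp (hu.const_mul_atTop_of_neg ?_)
        have : 0 < (n : ℝ) ^ 2 := by positivity
        nlinarith [Real.pi_pos]
    · filter_upwards [hu.eventually_ge_atTop 1] with t ht n
      rw [hnorm]
      simp only [pow_zero, one_mul, mul_zero, zero_mul, sub_zero]
      rw [Real.exp_le_exp]
      have : 0 ≤ Real.pi * (n : ℝ) ^ 2 := by positivity
      nlinarith
  rw [tsum_ite_eq] at h1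
  refine h1.congr' ?_
  filter_upwards [hu.eventually_gt_atTop 0] with t ht
  rw [Complex.tsum_exp_neg_quadratic ht]
  have : Complex.I * (-Complex.I * α) = α := by
    rw [← mul_assoc, mul_neg, Complex.I_mul_I]; ring
  simp_rw [this]

theorem summable_gaussian {w : ℂ} (hw : 0 < w.re) (β : ℝ) :
    Summable fun n : ℤ => Complex.exp (-Real.pi * w * ((n : ℂ) + β) ^ 2) := by
  have h := (summable_jacobiTheta₂_term_iff (Complex.I * w * β) (Complex.I * w)).2
    (by simpa using hw)
  refine (h.mul_left (Complex.exp (-Real.pi * w * β ^ 2))).congr fun n => ?_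
  rw [jacobiTheta₂_term, ← Complex.exp_add]
  congr 1
  linear_combination (2 * Real.pi * n * w * β + Real.pi * n ^ 2 * w) * Complex.I_mul_I

theorem tsum_int_eq_sum_residues {f : ℤ → ℂ} (hf : Summable f) {N : ℕ} (hN : 0 < N) :
    ∑' n, f n = ∑ k ∈ Finset.range N, ∑' q : ℤ, f (q * N + k) := by
  have : NeZero N := ⟨hN.ne'⟩
  rw [← (Int.divModEquiv N).symm.tsum_eq f]
  have hs : Summable fun p : ℤ × Fin N => f ((Int.divModEquiv N).symm p) :=
    (Int.divModEquiv N).symm.summable_iff.2 hf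
  rw [← (Equiv.prodComm (Fin N) ℤ).tsum_eq]
  have hs' := (Equiv.prodComm (Fin N) ℤ).summable_iff.2 hs
  refine hs'.tsum_prod.trans ?_
  rw [tsum_fintype, Finset.sum_range]
  rfl

open Filter Topology in
/-- The normalised Gaussian sum twisted by an `N`-periodic function tends to the sum of this
function over a period. -/
theorem tendsto_periodic_gaussian_tsum {ι : Type*} {l : Filter ι} {u : ι → ℂ}
    (hu : Tendsto (fun t => (u t).re) l atTop) (β : ℝ) {N : ℕ} (hN : 0 < N) {χ : ℤ → ℂ}
    (hχ : ∀ q k : ℤ, χ (q * N + k) = χ k) (hχ1 : ∀ k, ‖χ k‖ ≤ 1) :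
    Tendsto (fun t => 1 / (u t) ^ (1 / 2 : ℂ) *
      ∑' n : ℤ, χ n * Complex.exp (-Real.pi / ((N : ℂ) ^ 2 * u t) * ((n : ℂ) + β) ^ 2)) l
      (𝓝 (∑ k ∈ Finset.range N, χ k)) := by
  have hN' : (N : ℂ) ≠ 0 := by exact_mod_cast hN.ne'
  have h1 : Tendsto (fun t => ∑ k ∈ Finset.range N, χ k * (1 / (u t) ^ (1 / 2 : ℂ) *
      ∑' q : ℤ, Complex.exp (-Real.pi / u t * ((q : ℂ) + ((k + β) / N : ℝ)) ^ 2))) l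
      (𝓝 (∑ k ∈ Finset.range N, χ k * 1)) :=
    tendsto_finsetSum _ fun k _ => (tendsto_gaussian_tsum hu _).const_mul _
  simp only [mul_one] at h1
  refine h1.congr' ?_
  filter_upwards [hu.eventually_gt_atTop 0] with t ht
  have hu0 : u t ≠ 0 := by rintro h; simp [h] at ht
  have hw : 0 < (1 / ((N : ℂ) ^ 2 * u t)).re := by
    have : (1 / ((N : ℂ) ^ 2 * u t)) = ((1 / (N : ℝ) ^ 2 : ℝ) : ℂ) * (u t)⁻¹ := by
      push_cast; field_simp
    rw [this, Complex.re_ofReal_mul, Complex.inv_re]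
    have := Complex.normSq_pos.2 hu0
    positivity
  have hs : Summable fun n : ℤ =>
      χ n * Complex.exp (-Real.pi / ((N : ℂ) ^ 2 * u t) * ((n : ℂ) + β) ^ 2) := by
    refine Summable.of_norm_bounded (summable_gaussian hw β).norm fun n => ?_
    rw [norm_mul, show -Real.pi / ((N : ℂ) ^ 2 * u t) =
      -Real.pi * (1 / ((N : ℂ) ^ 2 * u t)) by ring]
    exact mul_le_of_le_one_left (norm_nonneg _) (hχ1 n)
  rw [tsum_int_eq_sum_residues hs hN, Finset.mul_sum]
  refine Finset.sum_congr rfl fun k _ => ?_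
  rw [mul_left_comm, ← tsum_mul_left]
  congr 1
  refine tsum_congr fun q => ?_
  rw [hχ]
  congr 2
  push_cast
  field_simp
  ring

theorem ofReal_mul_cpow {x : ℝ} (hx : 0 < x) {z : ℂ} (hz : z ≠ 0) (s : ℂ) :
    ((x : ℂ) * z) ^ s = (x : ℂ) ^ s * z ^ s := by
  have hx' : (x : ℂ) ≠ 0 := by exact_mod_cast hx.ne'
  rw [Complex.cpow_def_of_ne_zero (mul_ne_zero hx' hz), Complex.cpow_def_of_ne_zero hx',
    Complex.cpow_def_of_ne_zero hz, Complex.log_ofReal_mul hx hz, ← Complex.exp_add,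
    Complex.ofReal_log hx.le, add_mul]

theorem ofReal_cpow_half {x : ℝ} (hx : 0 ≤ x) : (x : ℂ) ^ (1 / 2 : ℂ) = (Real.sqrt x : ℂ) := by
  rw [Real.sqrt_eq_rpow, Complex.ofReal_cpow hx]
  norm_num

theorem one_add_I_mul_cpow_half_neg_I :
    (1 + Complex.I) * (-Complex.I) ^ (1 / 2 : ℂ) = (Real.sqrt 2 : ℂ) := by
  rw [Complex.cpow_def_of_ne_zero (neg_ne_zero.2 Complex.I_ne_zero), Complex.log_neg_I,
    show -(Real.pi / 2 : ℂ) * Complex.I * (1 / 2) = ((-(Real.pi / 4) : ℝ) : ℂ) * Complex.I by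
      push_cast; ring, Complex.exp_mul_I, ← Complex.ofReal_cos, ← Complex.ofReal_sin,
    Real.cos_neg, Real.sin_neg, Real.cos_pi_div_four, Real.sin_pi_div_four]
  push_cast
  linear_combination (-(Real.sqrt 2 : ℂ) / 2) * Complex.I_mul_I

open Filter Topology in
/-- Reciprocity for quadratic Gauss sums. -/
theorem gauss_sum_reciprocity {R m : ℕ} (hR : 0 < R) (hm : 0 < m) (c : ℤ) :
    (∑ j ∈ Finset.range (2 * R), eRat (((m * (j : ℤ) ^ 2 + 2 * c * j : ℤ) : ℚ) / (4 * R))) *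
        (Real.sqrt m : ℂ) =
      (1 + Complex.I) * (Real.sqrt R : ℂ) *
        ∑ k ∈ Finset.range m, eRat (-((2 * R * (k : ℤ) - c : ℤ) : ℚ) ^ 2 / (4 * R * m)) := by
  have hRr : (0 : ℝ) < R := by exact_mod_cast hR
  have hmr : (0 : ℝ) < m := by exact_mod_cast hm
  have hRc : (R : ℂ) ≠ 0 := by exact_mod_cast hR.ne'
  have hmc : (m : ℂ) ≠ 0 := by exact_mod_cast hm.ne'
  have hRq : (R : ℚ) ≠ 0 := by exact_mod_cast hR.ne'
  have hmq : (m : ℚ) ≠ 0 := by exact_mod_cast hm.ne'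
  set μ : ℝ := m / (2 * R) with hμ
  have hμ0 : 0 < μ := by positivity
  have hμc : (μ : ℂ) ≠ 0 := by exact_mod_cast hμ0.ne'
  have hμ' : (μ : ℂ) = m / (2 * R) := by rw [hμ]; push_cast; ring
  have h1 : Tendsto (fun t : ℝ => (((t / (2 * R) ^ 2 : ℝ) : ℂ)).re) atTop atTop := by
    simp only [Complex.ofReal_re]
    exact tendsto_id.atTop_div_const (by positivity)
  have h2 : Tendsto (fun t : ℝ => (((t / (2 * R) ^ 2 : ℝ) : ℂ) *
      (1 + Complex.I * ((1 / (μ * t) : ℝ) : ℂ))).re) atTop atTop := by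
    simp only [Complex.re_ofReal_mul]
    simpa only [Complex.ofReal_re, Complex.add_re, Complex.one_re, Complex.mul_re, Complex.I_re,
      zero_mul, Complex.I_im, Complex.ofReal_im, mul_zero, sub_zero, add_zero, mul_one] using h1
  have L1 := tendsto_periodic_gaussian_tsum h1 0 (N := 2 * R) (by positivity)
    (χ := fun j => eRat (((m * j ^ 2 + 2 * c * j : ℤ) : ℚ) / (4 * R)))
    (fun q k => by
      refine eRat_congr (m * (R * q ^ 2 + q * k) + c * q) ?_
      push_cast
      field_simp
      ring) (fun k => (norm_eRat _).le)
  have L2 := tendsto_periodic_gaussian_tsum h2 (-(c / (2 * R))) hm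
    (χ := fun k => eRat (-((2 * R * k - c : ℤ) : ℚ) ^ 2 / (4 * R * m)))
    (fun q k => by
      refine eRat_congr (-(R * m * q ^ 2 + q * (2 * R * k - c))) ?_
      push_cast
      field_simp
      ring) (fun k => (norm_eRat _).le)
  have hlim : Tendsto (fun t : ℝ => (1 + Complex.I * ((1 / (μ * t) : ℝ) : ℂ))) atTop (𝓝 1) := by
    have h0 : Tendsto (fun t : ℝ => 1 / (μ * t)) atTop (𝓝 0) := by
      simp only [one_div]
      exact (tendsto_id.const_mul_atTop hμ0).inv_tendsto_atTop
    have h3 := ((Complex.continuous_ofReal.tendsto 0).comp h0).const_mul Complex.I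
    simpa using h3.const_add 1
  have hlim2 : Tendsto (fun t : ℝ => (((1 / t : ℝ) : ℂ) - Complex.I * μ)) atTop
      (𝓝 (-Complex.I * μ)) := by
    have h0 : Tendsto (fun t : ℝ => 1 / t) atTop (𝓝 0) := by
      simp only [one_div]
      exact tendsto_inv_atTop_zero
    have h3 := ((Complex.continuous_ofReal.tendsto 0).comp h0).sub_const (Complex.I * μ)
    simpa using h3
  have L3 := (hlim.cpow (tendsto_const_nhds (x := (1 / 2 : ℂ))) (by simp)).mul L2
  have L4 := (hlim2.cpow (tendsto_const_nhds (x := (1 / 2 : ℂ)))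
    (by right; simp [hμ0.ne'])).mul L1
  have key := tendsto_nhds_unique (L4.congr' ?_) L3
  · rw [Complex.one_cpow, one_mul, mul_comm (-Complex.I),
      ofReal_mul_cpow hμ0 (neg_ne_zero.2 Complex.I_ne_zero), ofReal_cpow_half hμ0.le] at key
    push_cast at key ⊢
    rw [← key, show Real.sqrt m = Real.sqrt R * (Real.sqrt μ * Real.sqrt 2) by
      rw [← Real.sqrt_mul hμ0.le, ← Real.sqrt_mul hRr.le]
      congr 1
      rw [hμ]; field_simp]
    push_cast
    rw [← one_add_I_mul_cpow_half_neg_I]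
    ring
  · filter_upwards [eventually_gt_atTop 0] with t ht
    have htc : (t : ℂ) ≠ 0 := by exact_mod_cast ht.ne'
    have hz : (1 + Complex.I * ((1 / (μ * t) : ℝ) : ℂ)) ≠ 0 := by
      intro h
      simpa using congrArg Complex.re h
    have ha : 0 < (((1 / t : ℝ) : ℂ) - Complex.I * μ).re := by
      simpa using ht
    have ha0 : ((1 / t : ℝ) : ℂ) - Complex.I * μ ≠ 0 := by
      intro h
      rw [h] at ha
      exact lt_irrefl _ ha
    have hP := Complex.tsum_exp_neg_quadratic ha (Complex.I * c / (2 * R))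
    rw [ofReal_mul_cpow (by positivity) hz]
    have e1 : ∀ n : ℤ, Complex.exp (-Real.pi * (((1 / t : ℝ) : ℂ) - Complex.I * μ) * (n : ℂ) ^ 2 +
        2 * Real.pi * (Complex.I * c / (2 * R)) * n) =
        eRat (((m * n ^ 2 + 2 * c * n : ℤ) : ℚ) / (4 * R)) *
          Complex.exp (-Real.pi / (((2 * R : ℕ) : ℂ) ^ 2 * ((t / (2 * R) ^ 2 : ℝ) : ℂ)) *
            ((n : ℂ) + (0 : ℝ)) ^ 2) := by
      intro n
      rw [eRat, ← Complex.exp_add, hμ']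
      congr 1
      push_cast
      field_simp
      ring
    have e2 : ∀ n : ℤ, Complex.exp (-Real.pi / (((1 / t : ℝ) : ℂ) - Complex.I * μ) *
        ((n : ℂ) + Complex.I * (Complex.I * c / (2 * R))) ^ 2) =
        eRat (-((2 * R * n - c : ℤ) : ℚ) ^ 2 / (4 * R * m)) *
          Complex.exp (-Real.pi / ((m : ℂ) ^ 2 * (((t / (2 * R) ^ 2 : ℝ) : ℂ) *
            (1 + Complex.I * ((1 / (μ * t) : ℝ) : ℂ)))) *
            ((n : ℂ) + (-(c / (2 * R)) : ℝ)) ^ 2) := by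
      intro n
      rw [eRat, ← Complex.exp_add]
      congr 1
      have hI : Complex.I * (Complex.I * c / (2 * R)) = -(c / (2 * R)) := by
        linear_combination (c / (2 * R) : ℂ) * Complex.I_mul_I
      have ha' : -Real.pi / (((1 / t : ℝ) : ℂ) - Complex.I * μ) =
          -Real.pi * Complex.I / μ + -Real.pi / (μ ^ 2 * t *
            (1 + Complex.I * ((1 / (μ * t) : ℝ) : ℂ))) := by
        have hfac : ((1 / t : ℝ) : ℂ) - Complex.I * μ =
            -Complex.I * μ * (1 + Complex.I * ((1 / (μ * t) : ℝ) : ℂ)) := by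
          push_cast
          field_simp
          linear_combination Complex.I_mul_I
        rw [hfac]
        generalize hzz : (1 + Complex.I * ((1 / (μ * t) : ℝ) : ℂ)) = z at hz
        have hz' : μ * t * z = μ * t + Complex.I := by
          rw [← hzz]; push_cast; field_simp
        have hI0 := Complex.I_ne_zero
        field_simp
        linear_combination (-1 : ℂ) * hz' + μ * t * z * Complex.I_mul_I
      rw [hI, ha', hμ']
      generalize (1 + Complex.I * ((1 / (μ * t) : ℝ) : ℂ)) = z at hz
      push_cast
      field_simp
      ring
    simp_rw [e1, e2] at hP
    rw [hP]
    have half_ne : (1 / 2 : ℂ) ≠ 0 := by norm_num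
    have hz2 := (Complex.cpow_ne_zero_iff_of_exponent_ne_zero half_ne).2 hz
    have ha2 := (Complex.cpow_ne_zero_iff_of_exponent_ne_zero half_ne).2 ha0
    have hcancel : ∀ A Z U T : ℂ, A ≠ 0 → Z ≠ 0 →
        A * (1 / U * (1 / A * T)) = Z * (1 / (U * Z) * T) := by
      intro A Z U T hA hZ
      rw [one_div, one_div, one_div, mul_inv]
      field_simp
    exact hcancel _ _ _ _ ha2 hz2

theorem sum_range_shift_of_periodic {f : ℤ → ℂ} {N : ℕ} (hf : ∀ k, f (k + N) = f k) (q : ℤ) :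
    ∑ k ∈ Finset.range N, f (k + q) = ∑ k ∈ Finset.range N, f k := by
  have hstep : ∀ q : ℤ, ∑ k ∈ Finset.range N, f (k + (q + 1)) =
      ∑ k ∈ Finset.range N, f (k + q) := by
    intro q
    have h1 := Finset.sum_range_succ (fun k : ℕ => f (k + q)) N
    have h2 := Finset.sum_range_succ' (fun k : ℕ => f (k + q)) N
    rw [h1] at h2
    have h3 : f ((N : ℤ) + q) = f (((0 : ℕ) : ℤ) + q) := by
      rw [add_comm, hf]; simp
    rw [h3] at h2
    refine (add_right_cancel h2).symm ▸ Finset.sum_congr rfl fun k _ => ?_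
    congr 1
    push_cast
    ring
  induction q using Int.induction_on with
  | zero => simp
  | succ q ih => rw [hstep, ih]
  | pred q ih => rw [← hstep, sub_add_cancel, ih]

theorem sum_range_reflect_of_periodic {f : ℤ → ℂ} {N : ℕ} (hf : ∀ k, f (k + N) = f k) (q : ℤ) :
    ∑ k ∈ Finset.range N, f (-k + q) = ∑ k ∈ Finset.range N, f k := by
  rw [← Finset.sum_range_reflect, ← sum_range_shift_of_periodic hf (q - (N - 1))]
  refine Finset.sum_congr rfl fun k hk => ?_
  have := Finset.mem_range.1 hk
  congr 1
  omega

theorem sum_progression_of_periodic {P : ℤ → ℂ} {M N : ℕ} (hM : 0 < M)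
    (hP : ∀ δ, P (δ + M * N) = P δ) (d : ℤ) :
    ∑ k ∈ Finset.range N, P (M * (-k) + d) =
      ∑ δ ∈ (Finset.range (M * N)).filter (fun δ : ℕ => (δ : ℤ) ≡ d [ZMOD M]), P δ := by
  have hM' : (0 : ℤ) < M := by exact_mod_cast hM
  obtain ⟨s, hs⟩ := Int.eq_ofNat_of_zero_le (Int.emod_nonneg d hM'.ne')
  have hsM : s < M := by
    have := Int.emod_lt_of_pos d hM'
    omega
  have h1 := sum_range_reflect_of_periodic (f := fun k => P (M * k + s)) (N := N)
    (fun k => by rw [← hP (M * k + s)]; ring_nf) (d / M)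
  have h2 : ∀ k : ℤ, (M : ℤ) * (-k + d / M) + s = M * (-k) + d := by
    intro k
    rw [← hs]
    linear_combination Int.mul_ediv_add_emod d M
  simp only [h2] at h1
  rw [h1]
  refine Finset.sum_nbij' (fun k => M * k + s) (fun δ => δ / M) ?_ ?_ ?_ ?_ ?_
  · intro k hk
    rw [Finset.mem_range] at hk
    rw [Finset.mem_filter, Finset.mem_range]
    constructor
    · calc M * k + s < M * k + M := by omega
        _ = M * (k + 1) := by ring
        _ ≤ M * N := Nat.mul_le_mul_left _ hk
    · rw [Int.ModEq, ← Int.emod_emod_of_dvd d (dvd_refl (M : ℤ)), hs]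
      push_cast
      simp
  · intro δ hδ
    rw [Finset.mem_filter, Finset.mem_range] at hδ
    exact Finset.mem_range.2 (Nat.div_lt_of_lt_mul hδ.1)
  · intro k _
    rw [Nat.mul_add_div hM, Nat.div_eq_of_lt hsM, add_zero]
  · intro δ hδ
    rw [Finset.mem_filter] at hδ
    have h3 : δ % M = s := by
      have := hδ.2
      rw [Int.ModEq, hs] at this
      exact_mod_cast this
    rw [← h3, Nat.div_add_mod]
  · intro k _
    push_cast
    rfl

theorem sum_mul_sum_filter_modEq {g F : ℤ → ℂ} {M N : ℕ} (hM : 0 < M)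
    (hg : ∀ q k : ℤ, g (M * q + k) = g k) :
    ∑ j ∈ Finset.range M, g j *
        ∑ γ ∈ (Finset.range (M * N)).filter (fun γ : ℕ => (γ : ℤ) ≡ (j : ℤ) [ZMOD M]), F γ =
      ∑ γ ∈ Finset.range (M * N), g γ * F γ := by
  simp_rw [Finset.sum_filter, Finset.mul_sum]
  rw [Finset.sum_comm]
  refine Finset.sum_congr rfl fun γ _ => ?_
  rw [Finset.sum_eq_single (γ % M)]
  · rw [if_pos (by rw [Int.ModEq]; push_cast; simp)]
    congr 1
    rw [← hg (γ / M)]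
    congr 1
    exact_mod_cast Nat.div_add_mod γ M
  · intro j hj hne
    rw [if_neg, mul_zero]
    intro h
    apply hne
    have h' : γ % M = j % M := by
      rw [Int.ModEq] at h; exact_mod_cast h
    rw [h', Nat.mod_eq_of_lt (Finset.mem_range.1 hj)]
  · intro h
    exact absurd (Finset.mem_range.2 (Nat.mod_lt _ hM)) h

/-- Summation over one link of the chain. -/
theorem chain_link_sum {r b b' : ℕ} (hr : 0 < r) (hb : 0 < b) (hb' : 0 < b') (d : ℤ) :
    ∑ γ ∈ Finset.range (2 * r * b), eRat (((b' * (γ : ℤ) ^ 2 : ℤ) : ℚ) / (4 * r * b)) *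
        (eRat ((γ : ℚ) / (2 * b * r)) - eRat (-(γ : ℚ) / (2 * b * r))) *
        (eRat ((((γ : ℤ) * d : ℤ) : ℚ) / (2 * r)) - eRat (-(((γ : ℤ) * d : ℤ) : ℚ) / (2 * r))) =
      -2 * (1 + Complex.I) * (Real.sqrt r : ℂ) * (Real.sqrt b : ℂ) * (1 / (Real.sqrt b' : ℂ)) *
        ∑ δ ∈ (Finset.range (2 * r * b')).filter (fun δ : ℕ => (δ : ℤ) ≡ d [ZMOD (2 * (r : ℤ))]),
          (eRat (((-((b * (δ : ℤ) - 1) ^ 2) : ℤ) : ℚ) / (4 * b * b' * r)) -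
            eRat (((-((b * (δ : ℤ) + 1) ^ 2) : ℤ) : ℚ) / (4 * b * b' * r))) := by
  have hrq : (r : ℚ) ≠ 0 := by exact_mod_cast hr.ne'
  have hbq : (b : ℚ) ≠ 0 := by exact_mod_cast hb.ne'
  have hbq' : (b' : ℚ) ≠ 0 := by exact_mod_cast hb'.ne'
  have hsb : (Real.sqrt b' : ℂ) ≠ 0 := by
    have : (0 : ℝ) < b' := by exact_mod_cast hb'
    exact_mod_cast (Real.sqrt_pos.2 this).ne'
  set f : ℤ → ℤ → ℂ := fun c j => eRat (((b' * j ^ 2 + 2 * c * j : ℤ) : ℚ) / (4 * (r * b : ℕ)))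
    with hf
  have hfper : ∀ c j, f c (j + (2 * (r * b) : ℕ)) = f c j := by
    intro c j
    refine eRat_congr (b' * (j + r * b) + c) ?_
    push_cast
    field_simp
    ring
  have hneg : ∀ c, ∑ j ∈ Finset.range (2 * (r * b)), f (-c) j =
      ∑ j ∈ Finset.range (2 * (r * b)), f c j := by
    intro c
    rw [← sum_range_reflect_of_periodic (hfper c) 0]
    refine Finset.sum_congr rfl fun j _ => ?_
    simp only [hf]
    congr 2
    push_cast
    ring
  have hsplit : ∀ γ : ℕ, eRat (((b' * (γ : ℤ) ^ 2 : ℤ) : ℚ) / (4 * r * b)) *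
        (eRat ((γ : ℚ) / (2 * b * r)) - eRat (-(γ : ℚ) / (2 * b * r))) *
        (eRat ((((γ : ℤ) * d : ℤ) : ℚ) / (2 * r)) - eRat (-(((γ : ℤ) * d : ℤ) : ℚ) / (2 * r))) =
      f (b * d + 1) γ - f (b * d - 1) γ - (f (-(b * d - 1)) γ - f (-(b * d + 1)) γ) := by
    intro γ
    simp only [mul_sub, sub_mul, ← eRat_add, hf]
    refine congrArg₂ _ (congrArg₂ _ ?_ ?_) (congrArg₂ _ ?_ ?_) <;>
    · congr 1
      push_cast
      field_simp
      ring
  have hrec : ∀ ε : ℤ, (∑ j ∈ Finset.range (2 * (r * b)), f (b * d + ε) j) * (Real.sqrt b' : ℂ) =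
      (1 + Complex.I) * ((Real.sqrt r : ℂ) * (Real.sqrt b : ℂ)) * ∑ k ∈ Finset.range b',
        eRat (((-((b * (((2 * r : ℕ) : ℤ) * (-(k : ℤ)) + d) + ε) ^ 2) : ℤ) : ℚ) /
          (4 * b * b' * r)) := by
    intro ε
    have h := gauss_sum_reciprocity (R := r * b) (Nat.mul_pos hr hb) hb' (b * d + ε)
    have hsq : Real.sqrt ((r * b : ℕ) : ℝ) = Real.sqrt r * Real.sqrt b := by
      rw [Nat.cast_mul, Real.sqrt_mul (Nat.cast_nonneg r)]
    rw [hsq, Complex.ofReal_mul] at h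
    refine h.trans ?_
    congr 1
    refine Finset.sum_congr rfl fun k _ => ?_
    congr 1
    push_cast
    field_simp
    ring
  have hprog : ∀ ε : ℤ, (∑ k ∈ Finset.range b',
        eRat (((-((b * (((2 * r : ℕ) : ℤ) * (-(k : ℤ)) + d) + ε) ^ 2) : ℤ) : ℚ) /
          (4 * b * b' * r))) =
      ∑ δ ∈ (Finset.range (2 * r * b')).filter (fun δ : ℕ => (δ : ℤ) ≡ d [ZMOD (2 * (r : ℤ))]),
        eRat (((-((b * (δ : ℤ) + ε) ^ 2) : ℤ) : ℚ) / (4 * b * b' * r)) := by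
    intro ε
    have h := sum_progression_of_periodic (M := 2 * r) (N := b')
      (P := fun δ => eRat (((-((b * δ + ε) ^ 2) : ℤ) : ℚ) / (4 * b * b' * r)))
      (Nat.mul_pos two_pos hr) (fun δ => by
        refine eRat_congr (-(b * δ + ε + r * b * b')) ?_
        push_cast
        field_simp
        ring) d
    simpa only [Nat.cast_mul, Nat.cast_ofNat] using h
  have h1 := hrec 1
  have h2 := hrec (-1)
  rw [hprog] at h1 h2
  simp only [← sub_eq_add_neg] at h2
  rw [Finset.sum_congr rfl fun γ _ => hsplit γ, mul_assoc 2 r b]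
  simp only [Finset.sum_sub_distrib, hneg]
  generalize (∑ j ∈ Finset.range (2 * (r * b)), f (b * d + 1) j) = X at *
  generalize (∑ j ∈ Finset.range (2 * (r * b)), f (b * d - 1) j) = Y at *
  field_simp
  linear_combination 2 * h1 - 2 * h2

theorem contDenom_pos_lt {m : ℕ → ℤ} (n : ℕ) (hm : ∀ i, 1 ≤ i → i ≤ n + 1 → 2 ≤ m i) :
    0 < contDenom m n ∧ contDenom m n < contDenom m (n + 1) := by
  induction n with
  | zero =>
    have := hm 1 le_rfl le_rfl
    simp only [contDenom]
    omega
  | succ n ih =>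
    obtain ⟨h1, h2⟩ := ih fun i hi hi' => hm i hi (by omega)
    have h3 := hm (n + 2) (by omega) le_rfl
    refine ⟨h1.trans h2, ?_⟩
    rw [contDenom]
    nlinarith

theorem Ssum_one (r : ℕ) (m : ℕ → ℤ) (d : ℤ) :
    Ssum r 1 m d = ∑ j ∈ Finset.range (2 * r),
      eRat (((m 1 * (j : ℤ) ^ 2 : ℤ) : ℚ) / (4 * r)) *
        (eRat ((j : ℚ) / (2 * r)) - eRat (-(j : ℚ) / (2 * r))) *
        (eRat ((((j : ℤ) * d : ℤ) : ℚ) / (2 * r)) - eRat (-(((j : ℤ) * d : ℤ) : ℚ) / (2 * r))) := by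
  rw [Ssum]
  refine Finset.sum_nbij' (fun j => j 0) (fun k _ => k) ?_ ?_ ?_ ?_ ?_
  · intro j hj
    exact Fintype.mem_piFinset.1 hj 0
  · intro k hk
    exact Fintype.mem_piFinset.2 fun _ => hk
  · intro j _
    funext i
    rw [Subsingleton.elim i 0]
  · intro k _
    rfl
  · intro j _
    simp

theorem Ssum_succ (r n : ℕ) (hn : 1 ≤ n) (m : ℕ → ℤ) (d : ℤ) :
    Ssum r (n + 1) m d = ∑ j ∈ Finset.range (2 * r),
      eRat (((m (n + 1) * (j : ℤ) ^ 2 : ℤ) : ℚ) / (4 * r)) *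
        (eRat ((((j : ℤ) * d : ℤ) : ℚ) / (2 * r)) - eRat (-(((j : ℤ) * d : ℤ) : ℚ) / (2 * r))) *
        Ssum r n m j := by
  simp only [Ssum, Finset.mul_sum]
  rw [Finset.sum_sigma']
  refine Finset.sum_nbij' (fun j => ⟨j (Fin.last n), Fin.init j⟩)
    (fun x => Fin.snoc (α := fun _ => ℕ) x.2 x.1) ?_ ?_ ?_ ?_ ?_
  · intro j hj
    rw [Fintype.mem_piFinset] at hj
    exact Finset.mem_sigma.2 ⟨hj _, Fintype.mem_piFinset.2 fun i => hj _⟩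
  · rintro ⟨k, j⟩ hx
    rw [Finset.mem_sigma, Fintype.mem_piFinset] at hx
    refine Fintype.mem_piFinset.2 fun i => ?_
    induction i using Fin.lastCases with
    | last => simpa using hx.1
    | cast i => simpa using hx.2 i
  · intro j _
    simp
  · rintro ⟨k, j⟩ _
    simp
  · intro j _
    obtain ⟨k, rfl⟩ : ∃ k, n = k + 1 := ⟨n - 1, by omega⟩
    simp only [Nat.add_sub_cancel]
    have hJ : ∀ i, i < k + 1 → (if h : i < k + 1 + 1 then (j ⟨i, h⟩ : ℤ) else 0) =
        if h : i < k + 1 then (Fin.init j ⟨i, h⟩ : ℤ) else 0 := by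
      intro i hi
      rw [dif_pos hi, dif_pos (by omega)]
      rfl
    have hJl : (if h : k + 1 < k + 1 + 1 then (j ⟨k + 1, h⟩ : ℤ) else 0) = j (Fin.last (k + 1)) := by
      rw [dif_pos (by omega)]
      rfl
    rw [Finset.sum_range_succ, Finset.prod_range_succ, hJl, hJ k (by omega), hJ 0 (by omega),
      Finset.sum_congr rfl fun i hi => by rw [hJ i (Finset.mem_range.1 hi)],
      Finset.prod_congr rfl fun i hi => by
        have := Finset.mem_range.1 hi
        rw [hJ i (by omega), hJ (i + 1) (by omega)],
      Int.cast_add, add_div, eRat_add, mul_comm (dite _ _ _ : ℤ) (j (Fin.last (k + 1)) : ℤ)]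
    ring

theorem Ssum_eq (r : ℕ) (hr : 1 ≤ r) (m : ℕ → ℤ) (n : ℕ)
    (hm : ∀ i, 1 ≤ i → i ≤ n + 1 → 2 ≤ m i) (astar bcirc : ℤ) (hastar_pos : 0 < astar)
    (hastar_le : astar ≤ contDenom m (n + 1))
    (hbez : contDenom m n * astar + contDenom m (n + 1) * bcirc = 1) (d : ℤ) :
    Ssum r (n + 1) m d =
      (-2 * (1 + Complex.I) * (Real.sqrt r : ℂ)) ^ (n + 1) *
        (1 / (Real.sqrt ((contDenom m (n + 1) : ℤ) : ℝ) : ℂ)) *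
        eRat ((bcirc : ℚ) / (4 * (contDenom m n : ℚ) * (r : ℚ))) *
        ∑ γ ∈ (Finset.range (2 * r * (contDenom m (n + 1)).toNat)).filter
            (fun γ : ℕ => ((γ : ℤ) ≡ d [ZMOD (2 * (r : ℤ))])),
          (eRat (((-((contDenom m n * (γ : ℤ) - 1) ^ 2) : ℤ) : ℚ) /
              (4 * (contDenom m n : ℚ) * (contDenom m (n + 1) : ℚ) * (r : ℚ))) -
            eRat (((-((contDenom m n * (γ : ℤ) + 1) ^ 2) : ℤ) : ℚ) /
              (4 * (contDenom m n : ℚ) * (contDenom m (n + 1) : ℚ) * (r : ℚ)))) := by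
  have hrq : (r : ℚ) ≠ 0 := by exact_mod_cast (by omega : r ≠ 0)
  induction n generalizing astar bcirc d with
  | zero =>
    have hm1 := hm 1 le_rfl le_rfl
    simp only [contDenom] at hbez hastar_le ⊢
    obtain ⟨b', hb'⟩ := Int.eq_ofNat_of_zero_le (by omega : 0 ≤ m 1)
    have hbc : bcirc = 0 := by
      rcases lt_trichotomy bcirc 0 with h | h | h
      · nlinarith
      · exact h
      · nlinarith
    have key := chain_link_sum (r := r) (b := 1) (b' := b') hr one_pos (by omega) d
    rw [Ssum_one, hb']
    simp only [hbc, Int.cast_natCast, Int.toNat_natCast, Nat.cast_one, mul_one, Int.cast_one,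
      Real.sqrt_one, Complex.ofReal_one, Int.cast_zero, zero_div, zero_add, pow_one] at key ⊢
    rw [show eRat 0 = 1 by simp [eRat], mul_one]
    exact key
  | succ n ih =>
    obtain ⟨hA, hAB⟩ := contDenom_pos_lt n fun i hi hi' => hm i hi (by omega)
    obtain ⟨-, hBB'⟩ := contDenom_pos_lt (n + 1) hm
    have hrecur : contDenom m (n + 2) =
        m (n + 2) * contDenom m (n + 1) - contDenom m n := by rw [contDenom]
    have ih' := ih (fun i hi hi' => hm i hi (by omega)) (-bcirc) (astar + m (n + 2) * bcirc)
      (by nlinarith) (by nlinarith) (by rw [← hbez, hrecur]; ring)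
    rw [Ssum_succ r (n + 1) (by omega)]
    simp only [ih']
    obtain ⟨g, hg⟩ : ∃ g : ℤ → ℂ, ∀ j, g j = eRat (((m (n + 2) * j ^ 2 : ℤ) : ℚ) / (4 * r)) *
        (eRat (((j * d : ℤ) : ℚ) / (2 * r)) - eRat (-((j * d : ℤ) : ℚ) / (2 * r))) :=
      ⟨_, fun _ => rfl⟩
    have hper : ∀ q k : ℤ, g ((2 * r : ℕ) * q + k) = g k := by
      intro q k
      rw [hg, hg]
      refine congrArg₂ _ (eRat_congr (m (n + 2) * (r * q ^ 2 + q * k)) ?_)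
        (congrArg₂ _ (eRat_congr (q * d) ?_) (eRat_congr (-(q * d)) ?_)) <;>
      · push_cast
        field_simp
        ring
    change 0 < contDenom m n at hA
    generalize contDenom m n = a at *
    generalize contDenom m (n + 1) = b at *
    change b < contDenom m (n + 2) at hBB'
    generalize contDenom m (n + 2) = b' at *
    obtain ⟨B, rfl⟩ := Int.eq_ofNat_of_zero_le (by omega : 0 ≤ b)
    obtain ⟨B', rfl⟩ := Int.eq_ofNat_of_zero_le (by omega : 0 ≤ b')
    have haq : (a : ℚ) ≠ 0 := by exact_mod_cast hA.ne'
    have hBq : (B : ℚ) ≠ 0 := by exact_mod_cast (by omega : B ≠ 0)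
    have hBq' : (B' : ℚ) ≠ 0 := by exact_mod_cast (by omega : B' ≠ 0)
    have hfib := sum_mul_sum_filter_modEq (M := 2 * r) (N := B)
      (F := fun γ => eRat (((-((a * γ - 1) ^ 2) : ℤ) : ℚ) / (4 * a * B * r)) -
        eRat (((-((a * γ + 1) ^ 2) : ℤ) : ℚ) / (4 * a * B * r))) (by omega)
      hper
    have key := chain_link_sum (r := r) (b := B) (b' := B') hr (by omega) (by omega) d
    have hrecq : (B' : ℚ) = m (n + 2) * B - a := by exact_mod_cast hrecur
    have hbezq : (B : ℚ) * (astar + m (n + 2) * bcirc) - 1 = a * bcirc := by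
      have h : (B : ℚ) * astar + B' * bcirc = 1 := by exact_mod_cast hbez
      rw [hrecq] at h
      linear_combination h
    have hterm : ∀ γ : ℕ, g γ * (eRat (((-((a * (γ : ℤ) - 1) ^ 2) : ℤ) : ℚ) / (4 * a * B * r)) -
        eRat (((-((a * (γ : ℤ) + 1) ^ 2) : ℤ) : ℚ) / (4 * a * B * r))) =
        eRat (-1 / (4 * a * B * r)) * (eRat (((B' * (γ : ℤ) ^ 2 : ℤ) : ℚ) / (4 * r * B)) *
        (eRat ((γ : ℚ) / (2 * B * r)) - eRat (-(γ : ℚ) / (2 * B * r))) *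
        (eRat ((((γ : ℤ) * d : ℤ) : ℚ) / (2 * r)) -
          eRat (-(((γ : ℤ) * d : ℤ) : ℚ) / (2 * r)))) := by
      intro γ
      have hquad : ∀ ε : ℚ, ε ^ 2 = 1 → ∀ x : ℚ, x = -(a * γ - ε) ^ 2 / (4 * a * B * r) →
          eRat (((m (n + 2) * (γ : ℤ) ^ 2 : ℤ) : ℚ) / (4 * r)) * eRat x =
          eRat (-1 / (4 * a * B * r)) * eRat (((B' * (γ : ℤ) ^ 2 : ℤ) : ℚ) / (4 * r * B)) *
            eRat (ε * γ / (2 * B * r)) := by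
        intro ε hε x hx
        rw [← eRat_add, ← eRat_add, ← eRat_add, hx]
        congr 1
        push_cast
        rw [hrecq]
        field_simp
        linear_combination (-2 : ℚ) * hε
      have h1 := hquad 1 (by norm_num) (((-((a * (γ : ℤ) - 1) ^ 2) : ℤ) : ℚ) / (4 * a * B * r))
        (by push_cast; ring)
      have h2 := hquad (-1) (by norm_num)
        (((-((a * (γ : ℤ) + 1) ^ 2) : ℤ) : ℚ) / (4 * a * B * r)) (by push_cast; ring)
      rw [one_mul] at h1
      rw [neg_one_mul] at h2
      rw [hg]
      linear_combination (eRat ((((γ : ℤ) * d : ℤ) : ℚ) / (2 * r)) -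
          eRat (-(((γ : ℤ) * d : ℤ) : ℚ) / (2 * r))) * (h1 - h2)
    have hconst : eRat (bcirc / (4 * B * r)) =
        eRat ((astar + m (n + 2) * bcirc) / (4 * a * r)) * eRat (-1 / (4 * a * B * r)) := by
      rw [← eRat_add]
      congr 1
      field_simp
      linear_combination -hbezq
    simp only [hterm] at hfib
    rw [← Finset.mul_sum, key] at hfib
    have hsB : (Real.sqrt B : ℂ) ≠ 0 := by
      have : (0 : ℝ) < B := by exact_mod_cast (by omega : 0 < B)
      exact_mod_cast (Real.sqrt_pos.2 this).ne'
    simp only [← hg, Int.toNat_natCast, Int.cast_natCast]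
    simp only [mul_left_comm (g _), ← Finset.mul_sum]
    push_cast at hfib ⊢
    rw [hfib, hconst, pow_succ _ (n + 1)]
    field_simp

theorem stmt_12 (r n : ℕ) (hr : 1 ≤ r) (hn : 1 ≤ n) (m : ℕ → ℤ)
    (hm : ∀ i, 1 ≤ i → i ≤ n → 2 ≤ m i)
    (astar bcirc : ℤ) (hastar_pos : 0 < astar) (hastar_le : astar ≤ contDenom m n)
    (hbez : contDenom m (n - 1) * astar + contDenom m n * bcirc = 1)
    (d : ℤ) :
    Ssum r n m d =
      (-2 * (1 + Complex.I) * (Real.sqrt r : ℂ)) ^ n *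
        (1 / (Real.sqrt ((contDenom m n : ℤ) : ℝ) : ℂ)) *
        eRat ((bcirc : ℚ) / (4 * (contDenom m (n - 1) : ℚ) * (r : ℚ))) *
        ∑ γ ∈ (Finset.range (2 * r * (contDenom m n).toNat)).filter
            (fun γ : ℕ => ((γ : ℤ) ≡ d [ZMOD (2 * (r : ℤ))])),
          (eRat (((-((contDenom m (n - 1) * (γ : ℤ) - 1) ^ 2) : ℤ) : ℚ) /
              (4 * (contDenom m (n - 1) : ℚ) * (contDenom m n : ℚ) * (r : ℚ))) -
            eRat (((-((contDenom m (n - 1) * (γ : ℤ) + 1) ^ 2) : ℤ) : ℚ) /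
              (4 * (contDenom m (n - 1) : ℚ) * (contDenom m n : ℚ) * (r : ℚ)))) := by
  obtain ⟨k, rfl⟩ : ∃ k, n = k + 1 := ⟨n - 1, by omega⟩
  exact Ssum_eq r hr m k hm astar bcirc hastar_pos hastar_le hbez d
end

section
/- Let b be an odd positive integer and x, y integers with gcd(b, x) = 1. Let x* be an integer with x·x* ≡ 1 (mod b). Then ∑_{j=0}^{b−1} exp(−2πi(xj² + yj)/b) = ε(b) · (−x / b) · √b · exp(2πi·((b−1)²·x*·y²/4)/b), where (−x / b) is the Jacobi symbol. (Note (b−1)²/4 is an integer since b is odd, and the right-hand side does not depend on the choice of x*.) -/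
open Finset
open Filter Topology Complex
open scoped Real

lemma re_pos_of_inv_re_pos {z : ℂ} (hz : 0 < (z⁻¹).re) : 0 < z.re := by
  rw [inv_re] at hz
  exact pos_of_mul_pos_left (by simpa [div_eq_mul_inv] using hz) (inv_nonneg.2 (normSq_nonneg z))

lemma sqrt_mul_tsum_exp_neg_sq {a : ℂ} (ha : 0 < a.re) (c : ℝ) :
    a ^ (1 / 2 : ℂ) * ∑' n : ℤ, cexp (-π * a * (n + c) ^ 2) =
      ∑' n : ℤ, cexp (-π * a⁻¹ * n ^ 2 + 2 * π * I * c * n) := by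
  have ha0 : a ≠ 0 := fun h => by simp [h] at ha
  have hs : a ^ (1 / 2 : ℂ) ≠ 0 := by simp [cpow_eq_zero_iff, ha0]
  have h := Complex.tsum_exp_neg_quadratic ha (-a * c)
  have h1 : ∀ n : ℤ, cexp (-π * a * (n + c) ^ 2) =
      cexp (-π * a * c ^ 2) * cexp (-π * a * n ^ 2 + 2 * π * (-a * c) * n) := fun n => by
    rw [← Complex.exp_add]; ring_nf
  have h2 : ∀ n : ℤ, cexp (-π / a * (n + I * (-a * c)) ^ 2) =
      cexp (π * a * c ^ 2) * cexp (-π * a⁻¹ * n ^ 2 + 2 * π * I * c * n) := fun n => by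
    rw [← Complex.exp_add]
    congr 1
    field_simp
    ring_nf
    simp only [I_sq]
    ring
  simp_rw [h1, tsum_mul_left, h, h2, tsum_mul_left]
  have h3 : cexp (-π * a * c ^ 2) * cexp (π * a * c ^ 2) = 1 := by
    rw [← Complex.exp_add]
    simp
  generalize ∑' n : ℤ, cexp (-π * a⁻¹ * n ^ 2 + 2 * π * I * c * n) = X
  rw [show ∀ s x y : ℂ, s * (x * (1 / s * (y * X))) = s * s⁻¹ * (x * y) * X by intros; ring,
    h3, mul_inv_cancel₀ hs, one_mul, one_mul]

lemma tendsto_sqrt_mul_tsum_exp_neg_sq {ι : Type*} {l : Filter ι} {a : ι → ℂ}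
    (ha : Tendsto (fun i => ((a i)⁻¹).re) l atTop) (c : ℝ) :
    Tendsto (fun i => a i ^ (1 / 2 : ℂ) * ∑' n : ℤ, cexp (-π * a i * (n + c) ^ 2)) l (𝓝 1) := by
  have hnorm (z : ℂ) (n : ℤ) :
      ‖cexp (-π * z * n ^ 2 + 2 * π * I * c * n)‖ = Real.exp (-π * z.re * n ^ 2) := by
    rw [Complex.norm_exp]
    congr 1
    have : (-π * z * n ^ 2 + 2 * π * I * c * n : ℂ) =
        ((-π * n ^ 2 : ℝ) : ℂ) * z + ((2 * π * c * n : ℝ) : ℂ) * I := by push_cast; ring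
    rw [this, add_re, re_ofReal_mul, re_ofReal_mul]
    simp
    ring
  have hlim : Tendsto (fun i => ∑' n : ℤ, cexp (-π * (a i)⁻¹ * n ^ 2 + 2 * π * I * c * n)) l
      (𝓝 (∑' n : ℤ, if n = 0 then 1 else 0)) := by
    refine tendsto_tsum_of_dominated_convergence (bound := fun n : ℤ => Real.exp (-π * n ^ 2))
      ?_ (fun n => ?_) ?_
    · have := ((summable_jacobiTheta₂_term_iff 0 I).2 (by simp)).norm
      simpa [norm_jacobiTheta₂_term] using this
    · by_cases hn : n = 0
      · simp [hn, tendsto_const_nhds]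
      · rw [if_neg hn, tendsto_zero_iff_norm_tendsto_zero]
        simp_rw [hnorm]
        refine Real.tendsto_exp_atBot.comp ?_
        have hpos : (0 : ℝ) < π * n ^ 2 := by positivity
        have := (tendsto_neg_atTop_atBot.comp (ha.const_mul_atTop hpos))
        refine this.congr fun i => ?_
        simp; ring
    · filter_upwards [ha.eventually_ge_atTop 1] with i hi n
      rw [hnorm]
      refine Real.exp_le_exp.2 ?_
      have : 0 ≤ π * (n : ℝ) ^ 2 := by positivity
      nlinarith
  rw [tsum_ite_eq] at hlim
  refine hlim.congr' ?_
  filter_upwards [ha.eventually_gt_atTop 0] with i hi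
  exact (sqrt_mul_tsum_exp_neg_sq (re_pos_of_inv_re_pos hi) c).symm

lemma tsum_int_eq_sum_range_tsum {f : ℤ → ℂ} (hf : Summable f) (N : ℕ) [NeZero N] :
    ∑' m, f m = ∑ r ∈ range N, ∑' l : ℤ, f (l * N + r) := by
  let e := (Equiv.prodComm (Fin N) ℤ).trans (Int.divModEquiv N).symm
  rw [← e.tsum_eq, Summable.tsum_prod (f := fun p => f (e p)) (e.summable_iff.2 hf), tsum_fintype,
    ← Fin.sum_univ_eq_sum_range (fun r => ∑' l : ℤ, f (l * N + r))]
  simp [e]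

lemma tendsto_sqrt_mul_tsum_periodic {ι : Type*} {l : Filter ι} {a : ι → ℂ}
    (ha : Tendsto (fun i => ((a i)⁻¹).re) l atTop) (N : ℕ) [NeZero N] {h : ℤ → ℂ}
    (hper : ∀ l r : ℤ, h (l * N + r) = h r) (hbd : ∀ m, ‖h m‖ ≤ 1) :
    Tendsto (fun i => a i ^ (1 / 2 : ℂ) * ∑' m : ℤ, h m * cexp (-π * (a i / N ^ 2) * m ^ 2)) l
      (𝓝 (∑ r ∈ range N, h r)) := by
  have hN : (N : ℂ) ≠ 0 := NeZero.ne _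
  have key : Tendsto (fun i => ∑ r ∈ range N, h r * (a i ^ (1 / 2 : ℂ) *
      ∑' n : ℤ, cexp (-π * a i * (n + ((r / N : ℝ) : ℂ)) ^ 2))) l
      (𝓝 (∑ r ∈ range N, h r * 1)) :=
    tendsto_finsetSum _ fun r _ => (tendsto_sqrt_mul_tsum_exp_neg_sq ha _).const_mul _
  simp only [mul_one] at key
  refine key.congr' ?_
  filter_upwards [ha.eventually_gt_atTop 0] with i hi
  have hre := re_pos_of_inv_re_pos hi
  have hs : Summable fun m : ℤ => h m * cexp (-π * (a i / N ^ 2) * m ^ 2) := by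
    have hτ : 0 < (I * (a i / N ^ 2)).im := ?_
    · have := ((summable_jacobiTheta₂_term_iff 0 (I * (a i / N ^ 2))).2 hτ).norm
      refine Summable.of_norm_bounded this fun m => ?_
      rw [norm_mul]
      refine (mul_le_of_le_one_left (norm_nonneg _) (hbd m)).trans (le_of_eq ?_)
      rw [jacobiTheta₂_term]
      congr 2
      linear_combination (-π * (a i / N ^ 2) * m ^ 2) * I_mul_I
    · have : (a i / N ^ 2 : ℂ) = ((1 / N ^ 2 : ℝ) : ℂ) * a i := by push_cast; ring
      have hN' : (0 : ℝ) < N := by exact_mod_cast NeZero.pos N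
      rw [I_mul_im, this, re_ofReal_mul]
      positivity
  rw [tsum_int_eq_sum_range_tsum hs N, mul_sum]
  refine sum_congr rfl fun r _ => ?_
  simp_rw [hper, tsum_mul_left]
  rw [mul_left_comm]
  congr 2
  refine tsum_congr fun n => ?_
  congr 1
  push_cast
  field_simp

lemma ofReal_mul_cpow_s14 {t : ℝ} (ht : 0 < t) {w : ℂ} (hw : w ≠ 0) (s : ℂ) :
    ((t : ℂ) * w) ^ s = (t : ℂ) ^ s * w ^ s := by
  have ht' : (t : ℂ) ≠ 0 := by exact_mod_cast ht.ne'
  rw [cpow_def_of_ne_zero (mul_ne_zero ht' hw), cpow_def_of_ne_zero ht', cpow_def_of_ne_zero hw,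
    log_ofReal_mul ht hw, ← Complex.exp_add, ofReal_log ht.le]
  ring_nf

lemma sqrt_mul_sum_exp_sq (n : ℕ) [NeZero n] :
    (-2 * I / n) ^ (1 / 2 : ℂ) * ∑ j ∈ range n, cexp (2 * π * I * j ^ 2 / n) =
      1 + cexp (-π * I * n / 2) := by
  have hn : (n : ℂ) ≠ 0 := NeZero.ne _
  have hn' : (n : ℝ) ≠ 0 := NeZero.ne _
  set w : ℝ → ℂ := fun t => (1 + I * t / (2 * n))⁻¹ with hw
  set s : ℝ → ℂ := fun t => -2 * I / n * (1 + I * t / (2 * n)) with hs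
  have hden (t : ℝ) : (1 + I * t / (2 * n) : ℂ) ≠ 0 := fun h => by
    have := congrArg re h
    have e : (1 + I * t / (2 * n) : ℂ) = 1 + ((t / (2 * n) : ℝ) : ℂ) * I := by push_cast; ring
    rw [e, add_re, re_ofReal_mul] at this
    simp at this
  have hA : Tendsto (fun t : ℝ => (((t : ℂ))⁻¹).re) (𝓝[>] 0) atTop := by
    refine tendsto_inv_nhdsGT_zero.congr fun t => ?_
    rw [← ofReal_inv, ofReal_re]
  have hB : Tendsto (fun t : ℝ => (((t : ℂ) * w t)⁻¹).re) (𝓝[>] 0) atTop := by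
    refine hA.congr' ?_
    filter_upwards [self_mem_nhdsWithin] with t (ht : 0 < t)
    have ht' : (t : ℂ) ≠ 0 := by exact_mod_cast ht.ne'
    have : ((t : ℂ) * w t)⁻¹ = (t : ℂ)⁻¹ + ((1 / (2 * n) : ℝ) : ℂ) * I := by
      simp only [hw, mul_inv, inv_inv]
      push_cast
      field_simp
    rw [this]
    simp
  have hL := tendsto_sqrt_mul_tsum_periodic hA n (h := fun m => cexp (2 * π * I * m ^ 2 / n))
    (fun l r => by
      rw [Complex.exp_eq_exp_iff_exists_int]
      refine ⟨l ^ 2 * n + 2 * l * r, ?_⟩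
      push_cast
      field_simp
      ring)
    (fun m => by
      have : (2 * π * I * m ^ 2 / n : ℂ) = ((2 * π * m ^ 2 / n : ℝ) : ℂ) * I := by push_cast; ring
      rw [this, norm_exp_ofReal_mul_I])
  have hR := tendsto_sqrt_mul_tsum_periodic hB 2 (h := fun m => cexp (-π * I * n * m ^ 2 / 2))
    (fun l r => by
      rw [Complex.exp_eq_exp_iff_exists_int]
      refine ⟨-(n * l ^ 2 + n * l * r), ?_⟩
      push_cast
      field_simp
      ring)
    (fun m => by
      have : (-π * I * n * m ^ 2 / 2 : ℂ) = ((-π * n * m ^ 2 / 2 : ℝ) : ℂ) * I := by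
        push_cast; ring
      rw [this, norm_exp_ofReal_mul_I])
  have hwlim : Tendsto (fun t => w t ^ (1 / 2 : ℂ)) (𝓝[>] 0) (𝓝 1) := by
    have : ContinuousAt (fun t => w t ^ (1 / 2 : ℂ)) 0 := by
      refine ContinuousAt.cpow ?_ continuousAt_const ?_
      · refine ContinuousAt.inv₀ (by fun_prop) (hden 0)
      · simp [hw]
    have := this.tendsto.mono_left (nhdsWithin_le_nhds (s := Set.Ioi 0))
    simpa [hw] using this
  have hslim : Tendsto (fun t => s t ^ (1 / 2 : ℂ)) (𝓝[>] 0) (𝓝 ((-2 * I / n) ^ (1 / 2 : ℂ))) := by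
    have : ContinuousAt (fun t => s t ^ (1 / 2 : ℂ)) 0 := by
      refine ContinuousAt.cpow (by fun_prop) continuousAt_const (Or.inr ?_)
      have e : s 0 = ((-2 / n : ℝ) : ℂ) * I := by simp [hs]; ring
      rw [e]
      simp [hn']
    have := this.tendsto.mono_left (nhdsWithin_le_nhds (s := Set.Ioi 0))
    simpa [hs] using this
  have hLR := (hwlim.mul hslim).mul hL
  have heq : ∀ᶠ t : ℝ in 𝓝[>] 0, w t ^ (1 / 2 : ℂ) * s t ^ (1 / 2 : ℂ) * ((t : ℂ) ^ (1 / 2 : ℂ) *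
        ∑' m : ℤ, cexp (2 * π * I * m ^ 2 / n) * cexp (-π * (t / n ^ 2) * m ^ 2)) =
      ((t : ℂ) * w t) ^ (1 / 2 : ℂ) *
        ∑' m : ℤ, cexp (-π * I * n * m ^ 2 / 2) * cexp (-π * (t * w t / (2 : ℕ) ^ 2) * m ^ 2) := by
    filter_upwards [self_mem_nhdsWithin] with t (ht : 0 < t)
    have hse : s t = ((t / n ^ 2 : ℝ) : ℂ) + ((-2 / n : ℝ) : ℂ) * I := by
      simp only [hs]
      push_cast
      field_simp
      ring_nf
      simp only [I_sq]
      ring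
    have hsre : 0 < (s t).re := by
      have : (0 : ℝ) < n := by exact_mod_cast NeZero.pos n
      rw [hse, add_re, ofReal_re, re_ofReal_mul, I_re, mul_zero, add_zero]
      positivity
    have hs0 : s t ≠ 0 := fun h => by simp [h] at hsre
    have hss : s t ^ (1 / 2 : ℂ) ≠ 0 := by simp [cpow_eq_zero_iff, hs0]
    have hP := Complex.tsum_exp_neg_mul_int_sq hsre
    have e1 : ∀ m : ℤ, cexp (2 * π * I * m ^ 2 / n) * cexp (-π * (t / n ^ 2) * m ^ 2) =
        cexp (-π * s t * m ^ 2) := fun m => by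
      rw [← Complex.exp_add, hse]
      congr 1
      push_cast
      ring
    have e2 : ∀ m : ℤ, cexp (-π * I * n * m ^ 2 / 2) *
        cexp (-π * (t * w t / (2 : ℕ) ^ 2) * m ^ 2) = cexp (-π / s t * m ^ 2) := fun m => by
      rw [← Complex.exp_add]
      congr 1
      have hd := hden t
      have : (s t)⁻¹ = I * n / 2 + t * w t / 4 := by
        refine inv_eq_of_mul_eq_one_right ?_
        have hwd : w t * (1 + I * t / (2 * n)) = 1 := inv_mul_cancel₀ hd
        have : s t * (I * n / 2 + t * w t / 4) = -I ^ 2 * (1 + I * t / (2 * n)) -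
            I * t / (2 * n) * (w t * (1 + I * t / (2 * n))) := by
          simp only [hs]; field_simp; ring
        rw [this, hwd, I_sq]
        ring
      rw [div_eq_mul_inv (-π : ℂ) (s t), this]
      push_cast
      ring
    simp_rw [e1, e2, hP]
    rw [ofReal_mul_cpow_s14 ht (inv_ne_zero (hden t))]
    generalize w t ^ (1 / 2 : ℂ) = W
    field_simp
  have := tendsto_nhds_unique (hLR.congr' heq) hR
  simpa [sum_range_succ] using this

lemma sum_exp_sq_of_odd {n : ℕ} (hn : Odd n) :
    ∑ j ∈ range n, cexp (2 * π * I * j ^ 2 / n) = (if n % 4 = 1 then 1 else I) * (√n : ℝ) := by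
  have : NeZero n := ⟨hn.pos.ne'⟩
  have hn0 : (0 : ℝ) < n := by exact_mod_cast hn.pos
  have h := sqrt_mul_sum_exp_sq n
  have hsq : (√n : ℂ) ^ 2 = n := by
    exact_mod_cast Real.sq_sqrt hn0.le
  have hs0 : (√n : ℂ) ≠ 0 := by exact_mod_cast (Real.sqrt_pos.2 hn0).ne'
  have hroot : (-2 * I / n : ℂ) ^ (1 / 2 : ℂ) = (1 - I) / √n := by
    have e : (-2 * I / n : ℂ) = ((1 - I) / √n) ^ 2 := by
      rw [div_pow, hsq, sub_sq, I_sq]; ring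
    have e' : ((1 - I) / √n : ℂ) = ((1 / √n : ℝ) : ℂ) * (1 - I) := by push_cast; ring
    have hre : 0 < ((1 - I) / √n : ℂ).re := by
      rw [e', re_ofReal_mul]
      simp [hn0]
    have harg := abs_arg_lt_pi_div_two_iff.2 (Or.inl hre)
    rw [abs_lt] at harg
    have := Complex.pow_cpow_nat_inv (n := 2) (x := (1 - I) / √n) two_ne_zero
      (by push_cast; linarith [harg.1]) (by push_cast; linarith [harg.2])
    rw [e]
    simpa using this
  have hI : (1 - I : ℂ) ≠ 0 := fun h => by simpa using congrArg re h
  have hexp : ∀ k : ℕ, cexp (-π * I * (4 * k + 1 : ℕ) / 2) = -I ∧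
      cexp (-π * I * (4 * k + 3 : ℕ) / 2) = I := fun k => by
    have h1 : cexp (-π / 2 * I) = -I := exp_neg_pi_div_two_mul_I
    have h2 : cexp (π / 2 * I) = I := exp_pi_div_two_mul_I
    constructor
    · rw [← h1, Complex.exp_eq_exp_iff_exists_int]
      exact ⟨-k, by push_cast; ring⟩
    · nth_rw 2 [← h2]
      rw [Complex.exp_eq_exp_iff_exists_int]
      exact ⟨-(k + 1), by push_cast; ring⟩
  rw [hroot] at h
  have hmod : n % 4 = 1 ∨ n % 4 = 3 := by
    obtain ⟨k, hk⟩ := hn; omega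
  apply mul_left_cancel₀ (div_ne_zero hI hs0)
  rw [h]
  rcases hmod with hm | hm
  · obtain ⟨k, hk⟩ : ∃ k, n = 4 * k + 1 := ⟨n / 4, by omega⟩
    rw [if_pos hm]
    have := (hexp k).1
    rw [← hk] at this
    rw [this]
    field_simp
    ring
  · obtain ⟨k, hk⟩ : ∃ k, n = 4 * k + 3 := ⟨n / 4, by omega⟩
    rw [if_neg (by omega)]
    have := (hexp k).2
    rw [← hk] at this
    rw [this]
    field_simp
    linear_combination I_sq

/-- The quadratic Gauss sum `∑ j mod b, exp (2πi a j² / b)`. -/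
noncomputable def quadGaussSum (b : ℕ) [NeZero b] (a : ZMod b) : ℂ :=
  ∑ j : ZMod b, ZMod.stdAddChar (a * j ^ 2)

lemma sum_range_natCast_zmod (b : ℕ) [NeZero b] (f : ZMod b → ℂ) :
    ∑ j ∈ range b, f j = ∑ j : ZMod b, f j :=
  sum_bij' (fun j _ => (j : ZMod b)) (fun j _ => j.val) (by simp) (by simp [ZMod.val_lt])
    (fun j hj => ZMod.val_cast_of_lt (mem_range.1 hj)) (by simp) (by simp)

lemma quadGaussSum_one {b : ℕ} [NeZero b] (hb : Odd b) :
    quadGaussSum b 1 = (if b % 4 = 1 then 1 else I) * (√b : ℝ) := by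
  rw [← sum_exp_sq_of_odd hb, quadGaussSum, ← sum_range_natCast_zmod]
  refine sum_congr rfl fun j _ => ?_
  have := ZMod.stdAddChar_coe (N := b) ((j : ℤ) ^ 2)
  push_cast at this
  rw [one_mul, this]

lemma quadGaussSum_neg (b : ℕ) [NeZero b] (a : ZMod b) :
    quadGaussSum b (-a) = starRingEnd ℂ (quadGaussSum b a) := by
  simp_rw [quadGaussSum, map_sum, neg_mul, AddChar.map_neg_eq_conj]

lemma quadGaussSum_mul_quadGaussSum {a b : ℕ} [NeZero a] [NeZero b] (h : a.Coprime b) :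
    quadGaussSum a b * quadGaussSum b a = quadGaussSum (a * b) 1 := by
  set φ : ZMod a × ZMod b → ZMod (a * b) := fun p => ((b * p.1.val + a * p.2.val : ℕ) : ZMod (a * b))
    with hφ
  have hinj : Function.Injective φ := by
    rintro ⟨u, v⟩ ⟨u', v'⟩ huv
    have h1 := congrArg (ZMod.castHom (dvd_mul_right a b) (ZMod a)) huv
    have h2 := congrArg (ZMod.castHom (dvd_mul_left b a) (ZMod b)) huv
    simp only [hφ, map_natCast] at h1 h2
    have hub : IsUnit (b : ZMod a) := (ZMod.isUnit_iff_coprime b a).2 h.symm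
    have hua : IsUnit (a : ZMod b) := (ZMod.isUnit_iff_coprime a b).2 h
    simp [hub.mul_right_inj] at h1
    simp [hua.mul_right_inj] at h2
    rw [h1, h2]
  have hbij : Function.Bijective φ :=
    (Fintype.bijective_iff_injective_and_card φ).2 ⟨hinj, by simp [ZMod.card]⟩
  rw [quadGaussSum, quadGaussSum, quadGaussSum, sum_mul_sum, ← Fintype.sum_prod_type',
    ← hbij.sum_comp]
  refine sum_congr rfl fun p _ => ?_
  have ha : (a : ℂ) ≠ 0 := NeZero.ne _
  have hb : (b : ℂ) ≠ 0 := NeZero.ne _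
  have e1 := ZMod.stdAddChar_coe (N := a) (b * (p.1.val : ℤ) ^ 2)
  have e2 := ZMod.stdAddChar_coe (N := b) (a * (p.2.val : ℤ) ^ 2)
  have e3 := ZMod.stdAddChar_coe (N := a * b) ((b * p.1.val + a * p.2.val : ℤ) ^ 2)
  have e4 : φ p = (b * p.1.val + a * p.2.val : ZMod (a * b)) := by simp [hφ]
  simp only [Int.cast_mul, Int.cast_pow, Int.cast_add, Int.cast_natCast, ZMod.natCast_zmod_val]
    at e1 e2 e3
  rw [e1, e2, e4, one_mul, e3, ← Complex.exp_add, Complex.exp_eq_exp_iff_exists_int]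
  refine ⟨-(2 * p.1.val * p.2.val), ?_⟩
  push_cast
  field_simp
  ring

lemma quadGaussSum_natCast {b c : ℕ} [NeZero b] [NeZero c] (hb : Odd b) (hc : Odd c)
    (hbc : b.Coprime c)
    (h : quadGaussSum c b = (if c % 4 = 1 then 1 else I) * (jacobiSym b c : ℂ) * (√c : ℝ)) :
    quadGaussSum b c = (if b % 4 = 1 then 1 else I) * (jacobiSym c b : ℂ) * (√b : ℝ) := by
  have hmul := quadGaussSum_mul_quadGaussSum hbc
  rw [h, quadGaussSum_one (hb.mul hc), Nat.cast_mul, Real.sqrt_mul (Nat.cast_nonneg b),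
    Complex.ofReal_mul, Nat.mul_mod] at hmul
  have hc0 : ((√c : ℝ) : ℂ) ≠ 0 := by
    have : (0 : ℝ) < c := by exact_mod_cast hc.pos
    exact_mod_cast (Real.sqrt_pos.2 this).ne'
  have hodd {n : ℕ} (hn : Odd n) : n % 4 = 1 ∨ n % 4 = 3 := by
    obtain ⟨k, hk⟩ := hn; omega
  have hJ : jacobiSym b c = 1 ∨ jacobiSym b c = -1 :=
    jacobiSym.eq_one_or_neg_one (by simpa using hbc)
  have hQ : jacobiSym c b = if b % 4 = 3 ∧ c % 4 = 3 then -jacobiSym b c else jacobiSym b c := by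
    split_ifs with h3
    · exact jacobiSym.quadratic_reciprocity_three_mod_four h3.2 h3.1
    · rcases hodd hb with h1 | h1
      · exact jacobiSym.quadratic_reciprocity_one_mod_four' hc h1
      · exact jacobiSym.quadratic_reciprocity_one_mod_four
          ((hodd hc).resolve_right fun h => h3 ⟨h1, h⟩) hb
  rw [hQ]
  apply mul_right_cancel₀ hc0
  rcases hodd hb with h1 | h1 <;> rcases hodd hc with h2 | h2 <;> rcases hJ with h3 | h3 <;>
    simp only [h1, h2, h3] at hmul ⊢ <;>
    norm_num [-mul_eq_mul_right_iff, -mul_eq_mul_left_iff] at hmul ⊢ <;>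
    first
    | linear_combination hmul
    | linear_combination -hmul
    | linear_combination -I * hmul + quadGaussSum b c * (√c : ℝ) * I_mul_I
    | linear_combination I * hmul + quadGaussSum b c * (√c : ℝ) * I_mul_I
    | linear_combination -I * hmul + (quadGaussSum b c - (√b : ℝ)) * (√c : ℝ) * I_mul_I
    | linear_combination I * hmul + (quadGaussSum b c + (√b : ℝ)) * (√c : ℝ) * I_mul_I

lemma quadGaussSum_neg_eq {b : ℕ} [NeZero b] (hb : Odd b) {a : ℤ}
    (h : quadGaussSum b a = (if b % 4 = 1 then 1 else I) * (jacobiSym a b : ℂ) * (√b : ℝ)) :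
    quadGaussSum b (-a : ℤ) =
      (if b % 4 = 1 then 1 else I) * (jacobiSym (-a) b : ℂ) * (√b : ℝ) := by
  rw [Int.cast_neg, quadGaussSum_neg, h, jacobiSym.neg a hb]
  have hodd : b % 4 = 1 ∨ b % 4 = 3 := by
    obtain ⟨k, hk⟩ := hb; omega
  rcases hodd with h1 | h1
  · simp [h1, ZMod.χ₄_nat_one_mod_four h1]
  · simp [h1, ZMod.χ₄_nat_three_mod_four h1]

theorem quadGaussSum_eq (b : ℕ) [inst : NeZero b] (hb : Odd b) (a : ℤ) (hab : IsCoprime a b) :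
    quadGaussSum b a = (if b % 4 = 1 then 1 else I) * (jacobiSym a b : ℂ) * (√b : ℝ) := by
  induction b using Nat.strong_induction_on generalizing a inst with
  | _ b ih =>
  rcases eq_or_ne b 1 with rfl | hb1
  · simp [quadGaussSum, Subsingleton.elim _ (0 : ZMod 1)]
  have hb0 : (0 : ℤ) < b := by exact_mod_cast hb.pos
  have hodd_case : ∀ c : ℕ, Odd c → c < b → IsCoprime (c : ℤ) b →
      quadGaussSum b (c : ℤ) =
        (if b % 4 = 1 then 1 else I) * (jacobiSym c b : ℂ) * (√b : ℝ) := fun c hc hlt hcb => by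
    have : NeZero c := ⟨hc.pos.ne'⟩
    have := ih c hlt hc b hcb.symm
    rw [Int.cast_natCast] at this ⊢
    exact quadGaussSum_natCast hb hc (Nat.isCoprime_iff_coprime.1 hcb).symm this
  obtain ⟨r, hr⟩ := Int.eq_ofNat_of_zero_le (Int.emod_nonneg a hb0.ne')
  have hrb : r < b := by
    have := Int.emod_lt_of_pos a hb0
    omega
  have har : ((a : ℤ) : ZMod b) = ((r : ℤ) : ZMod b) := by
    rw [← hr, ZMod.intCast_mod]
  have hrc : IsCoprime (r : ℤ) b := by
    rw [← hr, Int.emod_def, sub_eq_add_neg, ← mul_neg]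
    exact IsCoprime.add_mul_left_left hab _
  rw [har, jacobiSym.mod_left, hr]
  rcases Nat.even_or_odd r with he | ho
  · have hrc' : IsCoprime ((b - r : ℕ) : ℤ) b := by
      rw [Nat.cast_sub hrb.le, sub_eq_neg_add]
      simpa using (IsCoprime.add_mul_left_left hrc.neg_left 1)
    have hr0 : r ≠ 0 := by
      rintro rfl
      have := Nat.isCoprime_iff_coprime.1 hrc
      simp at this
      exact hb1 this
    have := quadGaussSum_neg_eq hb
      (hodd_case (b - r) (Nat.Odd.sub_even hrb.le hb he) (by omega) hrc')
    have e : ((-((b - r : ℕ) : ℤ) : ℤ) : ZMod b) = ((r : ℤ) : ZMod b) := by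
      rw [Nat.cast_sub hrb.le]; simp
    rw [e] at this
    rw [this]
    congr 3
    refine jacobiSym.mod_left' ?_
    rw [Nat.cast_sub hrb.le]
    simp
  · exact hodd_case r ho hrb hrc

theorem stmt_14 (b : ℕ) (hb : 0 < b) (hbodd : Odd b) (x y xstar : ℤ)
    (hcop : Int.gcd (b : ℤ) x = 1) (hstar : x * xstar ≡ 1 [ZMOD (b : ℤ)]) :
    ∑ j ∈ Finset.range b,
        Complex.exp (-(2 * (Real.pi : ℂ) * Complex.I) * (x * j ^ 2 + y * j) / b) =
      (if b % 4 = 1 then (1 : ℂ) else Complex.I) * (jacobiSym (-x) b : ℂ) *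
        (Real.sqrt b : ℂ) *
        Complex.exp (2 * (Real.pi : ℂ) * Complex.I *
          ((((b : ℤ) - 1) ^ 2 * xstar * y ^ 2 / 4 : ℤ) : ℂ) / b) := by
  have : NeZero b := ⟨hb.ne'⟩
  obtain ⟨k, hk⟩ := hbodd
  have hquot : ((b : ℤ) - 1) ^ 2 * xstar * y ^ 2 / 4 = k ^ 2 * xstar * y ^ 2 := by
    rw [hk]
    push_cast
    rw [show ((2 * k + 1 - 1 : ℤ)) ^ 2 * xstar * y ^ 2 = k ^ 2 * xstar * y ^ 2 * 4 by ring]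
    exact Int.mul_ediv_cancel _ (by norm_num)
  have hk' : (2 * k : ZMod b) = -1 := by
    have : ((2 * k + 1 : ℕ) : ZMod b) = 0 := by rw [← hk]; simp
    push_cast at this
    exact eq_neg_of_add_eq_zero_left this
  have hx : (x * xstar : ZMod b) = 1 := by
    exact_mod_cast (ZMod.intCast_eq_intCast_iff _ _ b).2 hstar
  have hg := quadGaussSum_eq b ⟨k, hk⟩ (-x) (Int.isCoprime_iff_gcd_eq_one.2 hcop).symm.neg_left
  have hexp := ZMod.stdAddChar_coe (N := b) (k ^ 2 * xstar * y ^ 2)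
  rw [hquot, ← hg, ← hexp, quadGaussSum, sum_mul,
    ← (Equiv.subRight (k * xstar * y : ZMod b)).sum_comp, ← sum_range_natCast_zmod]
  refine sum_congr rfl fun j _ => ?_
  have hj := ZMod.stdAddChar_coe (N := b) (-(x * j ^ 2 + y * j))
  rw [← AddChar.map_add_eq_mul]
  have e : ((-x : ℤ) : ZMod b) * (Equiv.subRight (k * xstar * y : ZMod b) j) ^ 2 +
      ((k ^ 2 * xstar * y ^ 2 : ℤ) : ZMod b) = ((-(x * j ^ 2 + y * j) : ℤ) : ZMod b) := by
    simp only [Equiv.subRight_apply]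
    push_cast
    linear_combination (2 * k * y * j - k ^ 2 * xstar * y ^ 2) * hx + y * j * hk'
  rw [e, hj]
  push_cast
  ring_nf
end

section
/- Let b be an odd positive integer, n a positive integer coprime to b, and k ≥ 1. In the ring A = ℤ[1/b][q]/(Φ_n(q)^k), there exists a unique element y with y^b equal to the class of q; moreover this y is a unit of A. -/
open Polynomial

/-- A root of unity of odd order prime to `n` in the `n`-th cyclotomic field is trivial. -/
theorem eq_one_of_pow_eq_one_of_isCyclotomicExtension {n b : ℕ} [NeZero n] (hb : 0 < b)
    (hbodd : Odd b) (hcop : Nat.Coprime n b) {K : Type*} [Field K] [NumberField K]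
    [IsCyclotomicExtension {n} ℚ K] {w : K} (hw : w ^ b = 1) : w = 1 := by
  have h1 : orderOf w ∣ b := orderOf_dvd_of_pow_eq_one hw
  have h2 : orderOf w ∣ 2 * n :=
    (IsPrimitiveRoot.orderOf w).dvd_of_isCyclotomicExtension n (ne_zero_of_dvd_ne_zero hb.ne' h1)
  have h3 : Nat.Coprime b (2 * n) :=
    Nat.Coprime.mul_right (Nat.coprime_two_right.mpr hbodd) hcop.symm
  exact orderOf_eq_one_iff.mp (Nat.eq_one_of_dvd_coprimes h3 h1 h2)

/-- Over a subring of `ℚ`, a polynomial is divisible by `Φ_n` if it vanishes at a primitive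
`n`-th root of unity. -/
theorem cyclotomic_dvd_of_eval₂_eq_zero {n : ℕ} (hn : 0 < n) {R : Type*} [CommRing R]
    {φ : R →+* ℚ} (hφ : Function.Injective φ) {K : Type*} [Field K] [CharZero K]
    {ζ : K} (hζ : IsPrimitiveRoot ζ n) {f : R[X]}
    (hf : f.eval₂ ((algebraMap ℚ K).comp φ) ζ = 0) : cyclotomic n R ∣ f := by
  rw [← map_dvd_map φ hφ (cyclotomic.monic n R), map_cyclotomic,
    cyclotomic_eq_minpoly_rat hζ hn]
  refine minpoly.dvd ℚ ζ ?_
  rw [aeval_def, eval₂_map, hf]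

/-- If `f ^ b` and `g ^ b` both agree with `X` modulo `Φ_n`, then so do `f` and `g`. -/
theorem cyclotomic_dvd_sub_of_dvd_pow_sub_X {n b : ℕ} (hb : 0 < b) (hbodd : Odd b) (hn : 0 < n)
    (hcop : Nat.Coprime n b) {R : Type*} [CommRing R] {φ : R →+* ℚ}
    (hφ : Function.Injective φ) {f g : R[X]} (hf : cyclotomic n R ∣ f ^ b - X)
    (hg : cyclotomic n R ∣ g ^ b - X) : cyclotomic n R ∣ f - g := by
  have : NeZero n := ⟨hn.ne'⟩
  have : IsCyclotomicExtension {n} ℚ (CyclotomicField n ℚ) := by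
    convert CyclotomicField.isCyclotomicExtension n ℚ
    · rfl
    · exact Subsingleton.elim _ _
  have hζ : IsPrimitiveRoot (IsCyclotomicExtension.zeta n ℚ (CyclotomicField n ℚ)) n :=
    IsCyclotomicExtension.zeta_spec n ℚ (CyclotomicField n ℚ)
  set ζ := IsCyclotomicExtension.zeta n ℚ (CyclotomicField n ℚ)
  have hζ0 : ζ ≠ 0 := hζ.ne_zero hn.ne'
  let e : R[X] →+* CyclotomicField n ℚ := eval₂RingHom ((algebraMap ℚ _).comp φ) ζ
  have heX : e X = ζ := eval₂_X _ _
  have heΦ : e (cyclotomic n R) = 0 := by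
    change eval₂ _ _ _ = 0
    rw [← eval_map, map_cyclotomic]
    exact hζ.isRoot_cyclotomic hn
  have key : ∀ p : R[X], cyclotomic n R ∣ p ^ b - X → e p ^ b = ζ := fun p hp ↦ by
    have := map_dvd e hp
    rw [heΦ, zero_dvd_iff, map_sub, map_pow, heX] at this
    exact sub_eq_zero.mp this
  have hg0 : e g ≠ 0 := fun h ↦ hζ0 (by rw [← key g hg, h, zero_pow hb.ne'])
  have hq : e f / e g = 1 :=
    eq_one_of_pow_eq_one_of_isCyclotomicExtension (n := n) hb hbodd hcop
      (by rw [div_pow, key f hf, key g hg, div_self hζ0])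
  refine cyclotomic_dvd_of_eval₂_eq_zero hn hφ hζ ?_
  change e (f - g) = 0
  rw [map_sub, (div_eq_one_iff_eq hg0).mp hq, sub_self]

/-- The localization `ℤ[1/b]` embeds in `ℚ`. -/
theorem exists_injective_ringHom_rat_of_isLocalization_away {b : ℕ} (hb : 0 < b) (R : Type*)
    [CommRing R] [Algebra ℤ R] [IsLocalization.Away (b : ℤ) R] :
    ∃ φ : R →+* ℚ, Function.Injective φ := by
  have hM : Submonoid.powers (b : ℤ) ≤ nonZeroDivisors ℤ :=
    powers_le_nonZeroDivisors_of_noZeroDivisors (by exact_mod_cast hb.ne')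
  have hu : ∀ y : Submonoid.powers (b : ℤ), IsUnit (algebraMap ℤ ℚ y) := fun y ↦
    IsLocalization.map_units ℚ (⟨y, hM y.2⟩ : nonZeroDivisors ℤ)
  refine ⟨IsLocalization.lift (M := Submonoid.powers (b : ℤ)) (S := R) hu, ?_⟩
  refine IsLocalization.lift_injective_iff hu |>.mpr fun x y ↦ ?_
  rw [(IsLocalization.injective R hM).eq_iff, (IsFractionRing.injective ℤ ℚ).eq_iff]

/-- If `n` is coprime to `b`, some power of `X` is a `b`-th root of `X` modulo `Φ_n`. -/
theorem exists_cyclotomic_dvd_X_pow_pow_sub_X {n b : ℕ} (hn : 0 < n) (hcop : Nat.Coprime n b)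
    (R : Type*) [CommRing R] : ∃ m : ℕ, cyclotomic n R ∣ ((X : R[X]) ^ m) ^ b - X := by
  have hdvd : cyclotomic n R ∣ X ^ n - 1 := cyclotomic.dvd_X_pow_sub_one n R
  obtain ⟨m, -, hm⟩ := Nat.exists_mul_mod_eq_of_coprime 1 hcop.symm hn.ne'
  refine ⟨m, ?_⟩
  rw [← AdjoinRoot.mk_eq_zero] at hdvd ⊢
  rw [map_sub, sub_eq_zero, map_pow, map_one] at hdvd
  rw [map_sub, sub_eq_zero, map_pow, map_pow, ← pow_mul', pow_eq_pow_mod _ hdvd, hm,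
    ← pow_eq_pow_mod _ hdvd, pow_one]

theorem stmt_15 (b n k : ℕ) (hb : 0 < b) (hbodd : Odd b) (hn : 0 < n)
    (hk : 1 ≤ k) (hcop : Nat.Coprime n b)
    (R : Type) [CommRing R] [Algebra ℤ R] [IsLocalization.Away (b : ℤ) R] :
    (∃! y : R[X] ⧸ Ideal.span {(cyclotomic n R) ^ k},
        y ^ b = Ideal.Quotient.mk (Ideal.span {(cyclotomic n R) ^ k}) X) ∧
    (∀ y : R[X] ⧸ Ideal.span {(cyclotomic n R) ^ k},
        y ^ b = Ideal.Quotient.mk (Ideal.span {(cyclotomic n R) ^ k}) X → IsUnit y) := by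
  set I := Ideal.span {(cyclotomic n R) ^ k}
  have hnil : ∀ p : R[X], cyclotomic n R ∣ p → IsNilpotent (Ideal.Quotient.mk I p) := fun p hp ↦
    ⟨k, by
      rw [← map_pow, Ideal.Quotient.eq_zero_iff_mem, Ideal.mem_span_singleton]
      exact pow_dvd_pow_of_dvd hp k⟩
  have hX : IsUnit (Ideal.Quotient.mk I X) := by
    have h := (hnil _ (cyclotomic.dvd_X_pow_sub_one n R)).isUnit_add_one
    rw [← map_one (Ideal.Quotient.mk I), ← map_add, sub_add_cancel, map_pow] at h
    exact (isUnit_pow_iff hn.ne').mp h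
  have hunit : ∀ y : R[X] ⧸ I, y ^ b = Ideal.Quotient.mk I X → IsUnit y := fun y hy ↦
    (isUnit_pow_iff hb.ne').mp (hy ▸ hX)
  refine ⟨?_, hunit⟩
  have hbA : IsUnit (b : R[X] ⧸ I) := by
    have h := (IsLocalization.Away.algebraMap_isUnit (S := R) (b : ℤ)).map
      ((Ideal.Quotient.mk I).comp C)
    simpa using h
  obtain ⟨φ, hφ⟩ := exists_injective_ringHom_rat_of_isLocalization_away hb R
  obtain ⟨m, hm⟩ := exists_cyclotomic_dvd_X_pow_pow_sub_X hn hcop R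
  set y₀ : R[X] ⧸ I := Ideal.Quotient.mk I (X ^ m)
  set P : (R[X] ⧸ I)[X] := X ^ b - C (Ideal.Quotient.mk I X)
  have hP : ∀ y, aeval y P = y ^ b - Ideal.Quotient.mk I X := fun y ↦ by simp [P]
  have hP0 : IsNilpotent (aeval y₀ P) := by
    rw [hP, ← map_pow, ← map_sub]
    exact hnil _ hm
  have hP1 : IsUnit (aeval y₀ (derivative P)) := by
    have : aeval y₀ (derivative P) = b * y₀ ^ (b - 1) := by
      simp [P, derivative_X_pow]
    rw [this]
    have hy₀ : IsUnit y₀ := by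
      rw [show y₀ = Ideal.Quotient.mk I X ^ m from map_pow _ _ _]
      exact hX.pow m
    exact hbA.mul (hy₀.pow _)
  obtain ⟨y, ⟨-, hy⟩, huniq⟩ := existsUnique_nilpotent_sub_and_aeval_eq_zero hP0 hP1
  refine ⟨y, sub_eq_zero.mp (hP y ▸ hy), fun z hz ↦ huniq z ⟨?_, by rw [hP, hz, sub_self]⟩⟩
  obtain ⟨f, rfl⟩ := Ideal.Quotient.mk_surjective z
  rw [← map_sub]
  refine hnil _ (cyclotomic_dvd_sub_of_dvd_pow_sub_X hb hbodd hn hcop hφ hm ?_)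
  rw [← map_pow, Ideal.Quotient.eq, Ideal.mem_span_singleton] at hz
  exact (dvd_pow_self _ (by lia)).trans hz
end
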